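/- arXiv:2510.00944 — 9 statements merged into one kernel-verified Lean document; each statement's English description precedes it below -/
import Mathlib

section
/- Let (X,b,μ) be a connected weighted graph satisfying (FC). Assume there exists an intrinsic pseudo metric ρ for (X,b,μ) satisfying condition (B*). Let V = U − W where U, W : X → ℝ satisfy U(x) ≥ 0 and W(x) ≥ 0 for all x ∈ X, and suppose there exist constants c₁ ≥ 0 and c₂ ≥ 0 such that |∇W|²(x) ≤ c₁ + c₂·W(x) for all x ∈ X. Then the operator L_V restricted to C_c(X), viewed as a densely defined symmetric operator in ℓ²(X,μ), is essentially self-adjoint. -/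
open MeasureTheory
open scoped ENNReal

noncomputable section

/-- The formal discrete Schrödinger operator
`(L_V f)(x) = μ(x)⁻¹ ∑_y b(x,y)(f(x) − f(y)) + V(x) f(x)`. -/
def lapV {X : Type*} (b : X → X → ℝ) (μ : X → ℝ) (V : X → ℝ) (f : X → ℂ) (x : X) : ℂ :=
  (μ x : ℂ)⁻¹ * ∑' y, (b x y : ℂ) * (f x - f y) + (V x : ℂ) * f x

namespace SchrAux
section
variable {X : Type*}

lemma schur (a : X → X → ℝ) (ha : ∀ x y, 0 ≤ a x y) (M p : X → ℝ)
    (hs : ∀ x, Summable (a x)) (hM : ∀ x, ∑' y, a x y ≤ M x) (hp : ∀ x, 0 ≤ p x)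
    (hMp : Summable fun x => M x * p x) :
    Summable (fun z : X × X => a z.1 z.2 * p z.1) ∧
      ∑' z : X × X, a z.1 z.2 * p z.1 ≤ ∑' x, M x * p x := by
  have h0 : ∀ x, ∑' y, a x y * p x ≤ M x * p x := by
    intro x
    rw [tsum_mul_right]
    exact mul_le_mul_of_nonneg_right (hM x) (hp x)
  have h1 : Summable (fun x => ∑' y, a x y * p x) :=
    Summable.of_nonneg_of_le (fun x => tsum_nonneg fun y => mul_nonneg (ha x y) (hp x)) h0 hMp
  have h2 : Summable (fun z : X × X => a z.1 z.2 * p z.1) := by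
    have hn : 0 ≤ (fun z : X × X => a z.1 z.2 * p z.1) :=
      fun z => mul_nonneg (ha z.1 z.2) (hp z.1)
    exact (summable_prod_of_nonneg hn).mpr ⟨fun x => (hs x).mul_right (p x), h1⟩
  refine ⟨h2, ?_⟩
  rw [h2.tsum_prod]
  exact h1.tsum_le_tsum h0 hMp

lemma norm_ident (u v : ℂ) (s t : ℝ) :
    ‖(s:ℂ) * u - t * v‖ ^ 2 = s ^ 2 * (‖u‖ ^ 2 - (v * star u).re)
      + t ^ 2 * (‖v‖ ^ 2 - (u * star v).re) + (s - t) ^ 2 * (u * star v).re := by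
  simp only [Complex.sq_norm, Complex.normSq_apply, Complex.star_def]
  simp
  ring

lemma re_bound (u v : ℂ) : |(u * star v).re| ≤ (‖u‖ ^ 2 + ‖v‖ ^ 2) / 2 := by
  have h := Complex.abs_re_le_norm (u * star v)
  rw [norm_mul, norm_star] at h
  nlinarith [sq_nonneg (‖u‖ - ‖v‖)]

lemma swap_summable {E : Type*} [NormedAddCommGroup E] {F : X × X → E} (h : Summable F) :
    Summable (fun z : X × X => F (z.2, z.1)) :=
  (Equiv.prodComm X X).summable_iff.mpr h

lemma swap_tsum {E : Type*} [NormedAddCommGroup E] (F : X × X → E) :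
    ∑' z : X × X, F (z.2, z.1) = ∑' z, F z :=
  (Equiv.prodComm X X).tsum_eq F

/-- Summability facts for a weight localizing the graph. -/
structure Loc (b : X → X → ℝ) (μ Θ : X → ℝ) (K : ℝ) : Prop where
  nonneg : ∀ x, 0 ≤ Θ x
  le_one : ∀ x, Θ x ≤ 1
  K_nonneg : 0 ≤ K
  deg : ∀ x, ∑' y, b x y * Θ x ≤ K * μ x
  summ : ∀ x, Summable fun y => b x y * Θ y
  avg : ∀ x, ∑' y, b x y * Θ y ≤ K * μ x

lemma Loc.g1 {b : X → X → ℝ} {μ Θ : X → ℝ} {K : ℝ} (hL : Loc b μ Θ K)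
    (hb : ∀ x y, 0 ≤ b x y) (hbs : ∀ x, Summable fun z => b x z) (f : X → ℂ)
    (hf : Summable fun x => μ x * ‖f x‖ ^ 2) :
    Summable fun z : X × X => b z.1 z.2 * Θ z.1 * ‖f z.1‖ ^ 2 :=
  (schur (fun x y => b x y * Θ x) (fun x y => mul_nonneg (hb x y) (hL.nonneg x))
    (fun x => K * μ x) (fun x => ‖f x‖ ^ 2) (fun x => (hbs x).mul_right _) hL.deg
    (fun x => by positivity) (by simpa [mul_assoc] using hf.mul_left K)).1

lemma Loc.g2 {b : X → X → ℝ} {μ Θ : X → ℝ} {K : ℝ} (hL : Loc b μ Θ K)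
    (hb : ∀ x y, 0 ≤ b x y) (hsym : ∀ x y, b x y = b y x) (f : X → ℂ)
    (hf : Summable fun x => μ x * ‖f x‖ ^ 2) :
    Summable fun z : X × X => b z.1 z.2 * Θ z.1 * ‖f z.2‖ ^ 2 := by
  have := swap_summable (schur (fun x y => b x y * Θ y) (fun x y => mul_nonneg (hb x y) (hL.nonneg y))
    (fun x => K * μ x) (fun x => ‖f x‖ ^ 2) hL.summ hL.avg
    (fun x => by positivity) (by simpa [mul_assoc] using hf.mul_left K)).1
  refine this.congr fun z => ?_
  simp only
  rw [hsym z.2 z.1]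

/-- `(f,h)` in the graph of the maximal operator. -/
structure Pair (b : X → X → ℝ) (μ V : X → ℝ) (f h : X → ℂ) : Prop where
  f2 : Summable fun x => μ x * ‖f x‖ ^ 2
  h2 : Summable fun x => μ x * ‖h x‖ ^ 2
  fs : ∀ x, Summable fun y => (b x y : ℂ) * f y
  eq : ∀ x, (μ x : ℂ) * h x = f x * ((∑' y, b x y : ℝ) + μ x * V x) - ∑' y, (b x y : ℂ) * f y

/-- Energy estimate for one cutoff. -/
lemma energy_cut {b : X → X → ℝ} {μ V W θ : X → ℝ} {f h : X → ℂ} {K D : ℝ}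
    (hb : ∀ x y, 0 ≤ b x y) (hsym : ∀ x y, b x y = b y x) (hbs : ∀ x, Summable fun z => b x z)
    (hμ : ∀ x, 0 < μ x) (hP : Pair b μ V f h)
    (hL : Loc b μ (fun x => θ x ^ 2) K)
    (hVW : ∀ x, - W x ≤ V x) (hWθ : ∀ x, W x * θ x ^ 2 ≤ 1)
    (hgs : ∀ x, Summable fun y => b x y * (θ x - θ y) ^ 2)
    (hg : ∀ x, ∑' y, b x y * (θ x - θ y) ^ 2 ≤ D * μ x) (S : Finset (X × X)) :
    ∑ z ∈ S, b z.1 z.2 * ‖(θ z.1 : ℂ) * f z.1 - θ z.2 * f z.2‖ ^ 2 ≤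
      ∑' x, μ x * ‖h x‖ ^ 2 + (3 + D) * ∑' x, μ x * ‖f x‖ ^ 2 := by
  have hf2 := hP.f2
  have hh2 := hP.h2
  -- the basic form
  set A : X × X → ℝ := fun z => b z.1 z.2 * θ z.1 ^ 2 * (‖f z.1‖ ^ 2 - (f z.2 * star (f z.1)).re)
    with hA
  have hAs : Summable A := by
    have h1 := hL.g1 hb hbs f hf2
    have h2 := hL.g2 hb hsym f hf2
    refine Summable.of_norm_bounded ((h1.mul_left 2).add h2) fun z => ?_
    have h3 := re_bound (f z.2) (f z.1)
    have h4 : |‖f z.1‖ ^ 2 - (f z.2 * star (f z.1)).re| ≤ 2 * ‖f z.1‖ ^ 2 + ‖f z.2‖ ^ 2 := by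
      rw [abs_le] at h3 ⊢
      constructor <;> nlinarith [sq_nonneg ‖f z.1‖, sq_nonneg ‖f z.2‖]
    have h5 : 0 ≤ b z.1 z.2 * θ z.1 ^ 2 := mul_nonneg (hb _ _) (sq_nonneg _)
    rw [hA, Real.norm_eq_abs, abs_mul, abs_of_nonneg h5]
    nlinarith [mul_le_mul_of_nonneg_left h4 h5]
  have hAle : ∑' z, A z ≤ ∑' x, ((1/2) * (μ x * ‖h x‖ ^ 2) + (3/2) * (μ x * ‖f x‖ ^ 2)) := by
    rw [hAs.tsum_prod]
    refine hAs.prod.tsum_le_tsum (fun x => ?_) ((hh2.mul_left _).add (hf2.mul_left _))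
    have e1 : ∑' y, A (x, y) = θ x ^ 2 * ((∑' y, b x y) * ‖f x‖ ^ 2
        - ((∑' y, (b x y : ℂ) * f y) * star (f x)).re) := by
      have r1 : (∑' y, (b x y : ℂ) * f y) * star (f x)
          = ∑' y, (b x y : ℂ) * f y * star (f x) := tsum_mul_right.symm
      have s2 : Summable fun y => (b x y : ℂ) * f y * star (f x) := (hP.fs x).mul_right _
      rw [r1, Complex.re_tsum s2, ← tsum_mul_right,
        ← Summable.tsum_sub ((hbs x).mul_right _) (Complex.hasSum_re s2.hasSum).summable,
        ← tsum_mul_left]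
      congr 1; ext y
      simp only [hA]
      rw [mul_assoc (b x y : ℂ), Complex.re_ofReal_mul]
      ring
    have e2 : ((∑' y, (b x y : ℂ) * f y) * star (f x)).re
        = ((∑' y, b x y) + μ x * V x) * ‖f x‖ ^ 2 - μ x * (h x * star (f x)).re := by
      have := hP.eq x
      have e3 : ∑' y, (b x y : ℂ) * f y
        = f x * ((∑' y, b x y : ℝ) + μ x * V x) - (μ x : ℂ) * h x := by rw [this]; ring
      rw [e3, Complex.sq_norm, Complex.normSq_apply]
      generalize (∑' y, b x y) = B
      simp
      ring
    rw [e1, e2]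
    have h3 := re_bound (h x) (f x)
    have h4 := (abs_le.mp h3).2
    have t1 : θ x ^ 2 * (h x * star (f x)).re ≤ (‖h x‖ ^ 2 + ‖f x‖ ^ 2) / 2 := by
      have := hL.le_one x
      calc _ ≤ θ x ^ 2 * ((‖h x‖ ^ 2 + ‖f x‖ ^ 2) / 2) :=
            mul_le_mul_of_nonneg_left h4 (sq_nonneg _)
        _ ≤ 1 * _ := mul_le_mul_of_nonneg_right this (by positivity)
        _ = _ := one_mul _
    have t2 : - V x * θ x ^ 2 ≤ 1 := by
      nlinarith [hVW x, hWθ x, sq_nonneg (θ x)]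
    have t3 : - V x * θ x ^ 2 * ‖f x‖ ^ 2 ≤ ‖f x‖ ^ 2 := by
      nlinarith [sq_nonneg ‖f x‖]
    have := mul_le_mul_of_nonneg_left (add_le_add t1 t3) (hμ x).le
    linarith
  have hD := schur (fun x y => b x y * (θ x - θ y) ^ 2)
    (fun x y => mul_nonneg (hb x y) (sq_nonneg _)) (fun x => D * μ x) (fun x => ‖f x‖ ^ 2) hgs hg
    (fun x => by positivity) (by simpa [mul_assoc] using hf2.mul_left D)
  set G : X × X → ℝ := fun z => b z.1 z.2 * (θ z.1 - θ z.2) ^ 2 * ‖f z.1‖ ^ 2 with hG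
  have hGs : Summable G := hD.1
  have hGle : ∑' z, G z ≤ D * ∑' x, μ x * ‖f x‖ ^ 2 := by
    have := hD.2
    rw [← tsum_mul_left]
    simpa [mul_assoc, hG] using this
  set R : X × X → ℝ := fun z => (A z + A (z.2, z.1)) + (1/2) * (G z + G (z.2, z.1)) with hR
  have hRs : HasSum R ((∑' z, A z + ∑' z, A z) + (1/2) * (∑' z, G z + ∑' z, G z)) := by
    have a1 := (swap_summable hAs).hasSum
    have g1 := (swap_summable hGs).hasSum
    rw [swap_tsum] at a1 g1
    exact (hAs.hasSum.add a1).add ((hGs.hasSum.add g1).mul_left _)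
  have hle : ∀ z : X × X, b z.1 z.2 * ‖(θ z.1 : ℂ) * f z.1 - θ z.2 * f z.2‖ ^ 2 ≤ R z := by
    intro z
    rw [norm_ident]
    simp only [hR, hA, hG]
    rw [hsym z.2 z.1]
    have h3 := (abs_le.mp (re_bound (f z.1) (f z.2))).2
    have h5 : 0 ≤ b z.1 z.2 * (θ z.1 - θ z.2) ^ 2 := mul_nonneg (hb _ _) (sq_nonneg _)
    have := mul_le_mul_of_nonneg_left h3 h5
    nlinarith
  have hR0 : ∀ z, 0 ≤ R z := fun z => le_trans (mul_nonneg (hb _ _) (sq_nonneg _)) (hle z)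
  calc _ ≤ ∑ z ∈ S, R z := Finset.sum_le_sum fun z _ => hle z
    _ ≤ ∑' z, R z := hRs.summable.sum_le_tsum S fun z _ => hR0 z
    _ ≤ _ := by
      rw [hRs.tsum_eq]
      rw [Summable.tsum_add (hh2.mul_left _) (hf2.mul_left _), tsum_mul_left, tsum_mul_left] at hAle
      linarith

lemma am_gm (a c δ : ℝ) (hδ : 0 < δ) : a * c ≤ 1 / (2 * δ) * a ^ 2 + δ / 2 * c ^ 2 := by
  have : 1 / (2 * δ) * a ^ 2 + δ / 2 * c ^ 2 - a * c = (a - δ * c) ^ 2 / (2 * δ) := by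
    field_simp
    ring
  have h2 : 0 ≤ (a - δ * c) ^ 2 / (2 * δ) := by positivity
  linarith

lemma ptwise (fx fy gx gy : ℂ) (p wx wy δ : ℝ) (hx : 0 < wx) (hy : 0 < wy) (hδ : 0 < δ) :
    |p| * ‖star fx * gy - star fy * gx‖ ≤
      1 / (2 * δ) * (p ^ 2 * wy * (‖fx‖ ^ 2 + ‖gx‖ ^ 2)) +
      δ / 2 * (‖(((√wx)⁻¹ : ℝ) : ℂ) * fx - ((√wy)⁻¹ : ℝ) * fy‖ ^ 2
        + ‖(((√wx)⁻¹ : ℝ) : ℂ) * gx - ((√wy)⁻¹ : ℝ) * gy‖ ^ 2) := by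
  set s := √wx with hs
  set t := √wy with ht
  have hs0 : 0 < s := Real.sqrt_pos.mpr hx
  have ht0 : 0 < t := Real.sqrt_pos.mpr hy
  have ht2 : t ^ 2 = wy := Real.sq_sqrt hy.le
  have hsC : (s : ℂ) ≠ 0 := by exact_mod_cast hs0.ne'
  have htC : (t : ℂ) ≠ 0 := by exact_mod_cast ht0.ne'
  set dF := ((s⁻¹ : ℝ) : ℂ) * fx - (t⁻¹ : ℝ) * fy with hdF
  set dG := ((s⁻¹ : ℝ) : ℂ) * gx - (t⁻¹ : ℝ) * gy with hdG
  have key : star fx * gy - star fy * gx = (t : ℂ) * (star dF * gx - star fx * dG) := by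
    rw [hdF, hdG]
    simp only [Complex.star_def, map_sub, map_mul, Complex.conj_ofReal]
    push_cast
    field_simp
    ring
  have h1 : ‖star fx * gy - star fy * gx‖ ≤ t * (‖dF‖ * ‖gx‖ + ‖fx‖ * ‖dG‖) := by
    rw [key, norm_mul, Complex.norm_real, Real.norm_of_nonneg ht0.le]
    refine mul_le_mul_of_nonneg_left ((norm_sub_le _ _).trans ?_) ht0.le
    rw [norm_mul, norm_mul, norm_star, norm_star]
  have a1 := am_gm (|p| * t * ‖gx‖) ‖dF‖ δ hδ
  have a2 := am_gm (|p| * t * ‖fx‖) ‖dG‖ δ hδ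
  have h2 := mul_le_mul_of_nonneg_left h1 (abs_nonneg p)
  rw [mul_pow, mul_pow, sq_abs, ht2] at a1 a2
  linarith

/-- Green's formula with a cutoff, together with the estimate of the boundary term. -/
lemma green_cut {b : X → X → ℝ} {μ V Θ w M : X → ℝ} {f h g k : X → ℂ} {K δ : ℝ}
    (hb : ∀ x y, 0 ≤ b x y) (hsym : ∀ x y, b x y = b y x) (hbs : ∀ x, Summable fun z => b x z)
    (hw : ∀ x, 0 < w x) (hδ : 0 < δ)
    (hP : Pair b μ V f h) (hQ : Pair b μ V g k)
    (hL : Loc b μ Θ K)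
    (hgs : ∀ x, Summable fun y => b x y * ((Θ x - Θ y) ^ 2 * w y))
    (hg : ∀ x, ∑' y, b x y * ((Θ x - Θ y) ^ 2 * w y) ≤ M x)
    (hM : Summable fun x => M x * (‖f x‖ ^ 2 + ‖g x‖ ^ 2))
    (hEf : Summable fun z : X × X => b z.1 z.2 *
      ‖(((√(w z.1))⁻¹ : ℝ) : ℂ) * f z.1 - ((√(w z.2))⁻¹ : ℝ) * f z.2‖ ^ 2)
    (hEg : Summable fun z : X × X => b z.1 z.2 *
      ‖(((√(w z.1))⁻¹ : ℝ) : ℂ) * g z.1 - ((√(w z.2))⁻¹ : ℝ) * g z.2‖ ^ 2) :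
    2 * ‖∑' x, (Θ x : ℂ) * ((μ x : ℂ) * (star (h x) * g x - star (f x) * k x))‖ ≤
      1 / (2 * δ) * ∑' x, M x * (‖f x‖ ^ 2 + ‖g x‖ ^ 2) + δ / 2 *
      ((∑' z : X × X, b z.1 z.2 *
        ‖(((√(w z.1))⁻¹ : ℝ) : ℂ) * f z.1 - ((√(w z.2))⁻¹ : ℝ) * f z.2‖ ^ 2)
      + ∑' z : X × X, b z.1 z.2 *
        ‖(((√(w z.1))⁻¹ : ℝ) : ℂ) * g z.1 - ((√(w z.2))⁻¹ : ℝ) * g z.2‖ ^ 2) := by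
  set Q : X × X → ℂ := fun z => ((b z.1 z.2 * Θ z.1 : ℝ) : ℂ) *
    (star (f z.1) * g z.2 - star (f z.2) * g z.1) with hQd
  have hQs : Summable Q := by
    have f1 := hL.g1 hb hbs f hP.f2
    have f2 := hL.g2 hb hsym f hP.f2
    have g1 := hL.g1 hb hbs g hQ.f2
    have g2 := hL.g2 hb hsym g hQ.f2
    refine Summable.of_norm_bounded ((f1.add f2).add (g1.add g2)) fun z => ?_
    have h5 : 0 ≤ b z.1 z.2 * Θ z.1 := mul_nonneg (hb _ _) (hL.nonneg _)
    have h6 : ‖star (f z.1) * g z.2 - star (f z.2) * g z.1‖ ≤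
        ‖f z.1‖ ^ 2 + ‖f z.2‖ ^ 2 + (‖g z.1‖ ^ 2 + ‖g z.2‖ ^ 2) := by
      refine (norm_sub_le _ _).trans ?_
      rw [norm_mul, norm_mul, norm_star, norm_star]
      nlinarith [sq_nonneg (‖f z.1‖ - ‖g z.2‖), sq_nonneg (‖f z.2‖ - ‖g z.1‖),
        sq_nonneg (‖f z.1‖), sq_nonneg (‖f z.2‖), sq_nonneg (‖g z.1‖), sq_nonneg (‖g z.2‖)]
    rw [hQd, norm_mul, Complex.norm_real, Real.norm_of_nonneg h5]
    have := mul_le_mul_of_nonneg_left h6 h5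
    linarith
  have e1 : ∑' x, (Θ x : ℂ) * ((μ x : ℂ) * (star (h x) * g x - star (f x) * k x)) = ∑' z, Q z := by
    rw [hQs.tsum_prod]
    congr 1; ext x
    have hs1 := hQ.fs x
    have hs2 : Summable fun y => (b x y : ℂ) * star (f y) := by
      have := (hP.fs x).star
      refine this.congr fun y => ?_
      simp [mul_comm]
    have r1 : ∑' y, Q (x, y) = (Θ x : ℂ) * (star (f x) * (∑' y, (b x y : ℂ) * g y)
        - (∑' y, (b x y : ℂ) * star (f y)) * g x) := by
      rw [← tsum_mul_left, ← tsum_mul_right,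
        ← Summable.tsum_sub (hs1.mul_left _) (hs2.mul_right _), ← tsum_mul_left]
      congr 1; ext y
      simp only [hQd]
      push_cast
      ring
    have r2 : ∑' y, (b x y : ℂ) * star (f y) = star (∑' y, (b x y : ℂ) * f y) := by
      rw [tsum_star]
      congr 1; ext y
      simp [mul_comm]
    have q1 := hP.eq x
    have q2 := hQ.eq x
    have q3 : ∑' y, (b x y : ℂ) * f y
        = f x * ((∑' y, b x y : ℝ) + μ x * V x) - (μ x : ℂ) * h x := by rw [q1]; ring
    have q4 : ∑' y, (b x y : ℂ) * g y
        = g x * ((∑' y, b x y : ℝ) + μ x * V x) - (μ x : ℂ) * k x := by rw [q2]; ring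
    rw [r1, r2, q3, q4]
    generalize (∑' y, b x y) = B
    simp only [Complex.star_def, map_sub, map_mul, map_add, Complex.conj_ofReal]
    ring
  have e2 : HasSum (fun z => Q z + Q (z.2, z.1)) (∑' z, Q z + ∑' z, Q z) := by
    have a1 := (swap_summable hQs).hasSum
    rw [swap_tsum] at a1
    exact hQs.hasSum.add a1
  have hD := schur (fun x y => b x y * ((Θ x - Θ y) ^ 2 * w y))
    (fun x y => mul_nonneg (hb x y) (mul_nonneg (sq_nonneg _) (hw y).le)) M
    (fun x => ‖f x‖ ^ 2 + ‖g x‖ ^ 2) hgs hg (fun x => by positivity) hM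
  have hbd : HasSum _ _ := (hD.1.hasSum.mul_left (1 / (2 * δ))).add
    ((hEf.hasSum.add hEg.hasSum).mul_left (δ / 2))
  have hn := e2.norm_le_of_bounded hbd (fun z => by
    have hp := ptwise (f z.1) (f z.2) (g z.1) (g z.2) (Θ z.1 - Θ z.2) (w z.1) (w z.2) δ
      (hw _) (hw _) hδ
    have : Q z + Q (z.2, z.1) = ((b z.1 z.2 : ℝ) : ℂ) * (((Θ z.1 - Θ z.2 : ℝ) : ℂ) *
        (star (f z.1) * g z.2 - star (f z.2) * g z.1)) := by
      simp only [hQd]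
      rw [hsym z.2 z.1]
      push_cast
      ring
    rw [this, norm_mul, norm_mul, Complex.norm_real, Complex.norm_real,
      Real.norm_of_nonneg (hb _ _), Real.norm_eq_abs]
    have := mul_le_mul_of_nonneg_left hp (hb z.1 z.2)
    linarith)
  rw [e1]
  have : ‖∑' z, Q z + ∑' z, Q z‖ = 2 * ‖∑' z, Q z‖ := by
    rw [← two_mul, norm_mul]; simp
  rw [← this]
  refine hn.trans ?_
  have h1 : 0 ≤ 1 / (2 * δ) := by positivity
  have := mul_le_mul_of_nonneg_left hD.2 h1
  linarith

/-- The metric cutoff. -/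
def eta (ρ : X → X → ℝ) (o : X) (N : ℝ) (x : X) : ℝ := max 0 (1 - ρ o x / N)

/-- The standing geometric assumptions. -/
structure Geo (b : X → X → ℝ) (μ : X → ℝ) (ρ : X → X → ℝ) (w : X → ℝ) (C : ℝ) : Prop where
  hb : ∀ x y, 0 ≤ b x y
  hsym : ∀ x y, b x y = b y x
  hbs : ∀ x, Summable fun z => b x z
  hμ : ∀ x, 0 < μ x
  ρnn : ∀ x y, 0 ≤ ρ x y
  ρsym : ∀ x y, ρ x y = ρ y x
  ρtri : ∀ x y z, ρ x z ≤ ρ x y + ρ y z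
  ρs : ∀ x, Summable fun y => b x y * ρ x y ^ 2
  ρle : ∀ x, ∑' y, b x y * ρ x y ^ 2 ≤ μ x
  hB : ∀ o : X, ∀ r : ℝ, 0 ≤ r → ∃ C : ℝ, ∀ y, ρ o y ≤ r → (μ y)⁻¹ * ∑' z, b y z ≤ C
  w1 : ∀ x, 1 ≤ w x
  C0 : 0 ≤ C
  ws : ∀ x, Summable fun y => b x y * (w x - w y) ^ 2
  wle : ∀ x, ∑' y, b x y * (w x - w y) ^ 2 ≤ C * μ x * w x

variable {b : X → X → ℝ} {μ : X → ℝ} {ρ : X → X → ℝ} {w : X → ℝ} {C : ℝ}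

lemma eta_nonneg (o : X) (N : ℝ) (x : X) : 0 ≤ eta ρ o N x := le_max_left _ _

lemma Geo.eta_le_one (hG : Geo b μ ρ w C) (o : X) {N : ℝ} (hN : 1 ≤ N) (x : X) :
    eta ρ o N x ≤ 1 := by
  have : 0 ≤ ρ o x / N := div_nonneg (hG.ρnn _ _) (by linarith)
  exact max_le zero_le_one (by linarith)

lemma Geo.eta_lip (hG : Geo b μ ρ w C) (o : X) {N : ℝ} (hN : 1 ≤ N) (x y : X) :
    (eta ρ o N x - eta ρ o N y) ^ 2 ≤ ρ x y ^ 2 / N ^ 2 := by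
  have hN0 : 0 < N := by linarith
  have h1 : |eta ρ o N x - eta ρ o N y| ≤ |(1 - ρ o x / N) - (1 - ρ o y / N)| := by
    have := abs_max_sub_max_le_abs (1 - ρ o x / N) (1 - ρ o y / N) 0
    simpa [eta, max_comm] using this
  have h2 : |(1 - ρ o x / N) - (1 - ρ o y / N)| ≤ ρ x y / N := by
    have e : (1 - ρ o x / N) - (1 - ρ o y / N) = (ρ o y - ρ o x) / N := by ring
    rw [e, abs_div, abs_of_pos hN0]
    refine div_le_div_of_nonneg_right ?_ hN0.le
    rw [abs_le]
    have t1 := hG.ρtri o x y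
    have t2 := hG.ρtri o y x
    rw [hG.ρsym y x] at t2
    constructor <;> linarith
  rw [← div_pow, ← sq_abs]
  exact pow_le_pow_left₀ (abs_nonneg _) (h1.trans h2) 2

lemma Geo.eta_lip' (hG : Geo b μ ρ w C) (o : X) {N : ℝ} (hN : 1 ≤ N) (x y : X) :
    (eta ρ o N x - eta ρ o N y) ^ 2 ≤ ρ x y ^ 2 :=
  (hG.eta_lip o hN x y).trans (div_le_self (sq_nonneg _) (one_le_pow₀ hN))

lemma Geo.loc (hG : Geo b μ ρ w C) (o : X) {N : ℝ} (hN : 1 ≤ N) (Θ : X → ℝ)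
    (h0 : ∀ x, 0 ≤ Θ x) (h1 : ∀ x, Θ x ≤ eta ρ o N x ^ 2) : ∃ K, Loc b μ Θ K := by
  have hN0 : 0 < N := by linarith
  obtain ⟨C', hC'⟩ := hG.hB o N hN0.le
  have hle1 : ∀ x, Θ x ≤ 1 := fun x =>
    (h1 x).trans (pow_le_one₀ (eta_nonneg _ _ _) (hG.eta_le_one o hN x))
  have hdeg : ∀ x, eta ρ o N x ≠ 0 → ∑' y, b x y ≤ max C' 1 * μ x := by
    intro x hx
    have h2 : ρ o x ≤ N := by
      by_contra hc
      push Not at hc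
      apply hx
      have : 1 ≤ ρ o x / N := (one_le_div hN0).mpr hc.le
      exact max_eq_left (by linarith)
    have h3 := hC' x h2
    rw [inv_mul_le_iff₀ (hG.hμ x)] at h3
    have := mul_le_mul_of_nonneg_right (le_max_left C' 1) (hG.hμ x).le
    linarith
  have hs : ∀ x, Summable fun y => b x y * Θ y := fun x =>
    Summable.of_nonneg_of_le (fun y => mul_nonneg (hG.hb x y) (h0 y))
      (fun y => mul_le_of_le_one_right (hG.hb x y) (hle1 y)) (hG.hbs x)
  refine ⟨max C' 1, h0, hle1, le_trans zero_le_one (le_max_right _ _), ?_, hs, ?_⟩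
  · intro x
    rw [tsum_mul_right]
    have hBn : 0 ≤ ∑' y, b x y := tsum_nonneg (hG.hb x)
    by_cases hx : eta ρ o N x = 0
    · have : Θ x = 0 := le_antisymm (by simpa [hx] using h1 x) (h0 x)
      rw [this, mul_zero]
      exact mul_nonneg (le_trans zero_le_one (le_max_right _ _)) (hG.hμ x).le
    · exact (mul_le_of_le_one_right hBn (hle1 x)).trans (hdeg x hx)
  · intro x
    by_cases hx : eta ρ o N x = 0
    · calc ∑' y, b x y * Θ y ≤ ∑' y, b x y * ρ x y ^ 2 := by
            refine (hs x).tsum_le_tsum (fun y => mul_le_mul_of_nonneg_left ?_ (hG.hb x y)) (hG.ρs x)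
            have := hG.eta_lip' o hN x y
            rw [hx] at this
            have h2 := h1 y
            nlinarith
        _ ≤ 1 * μ x := by simpa using hG.ρle x
        _ ≤ _ := mul_le_mul_of_nonneg_right (le_max_right _ _) (hG.hμ x).le
    · exact ((hs x).tsum_le_tsum (fun y => mul_le_of_le_one_right (hG.hb x y) (hle1 y))
        (hG.hbs x)).trans (hdeg x hx)

lemma eta_tendsto (o x : X) :
    Filter.Tendsto (fun n : ℕ => eta ρ o ((n : ℝ) + 1) x) Filter.atTop (nhds 1) := by
  have h1 : Filter.Tendsto (fun n : ℕ => ρ o x / ((n : ℝ) + 1)) Filter.atTop (nhds 0) :=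
    by simpa [Function.comp_def] using
      (tendsto_const_div_atTop_nhds_zero_nat (ρ o x)).comp (Filter.tendsto_add_atTop_nat 1)
  have h2 := (tendsto_const_nhds (x := (0:ℝ))).max ((tendsto_const_nhds (x := (1:ℝ))).sub h1)
  simpa [eta] using h2

lemma psi_lip (a c : ℝ) (ha : 1 ≤ a) (hc : 1 ≤ c) :
    ((√a)⁻¹ - (√c)⁻¹) ^ 2 ≤ (a - c) ^ 2 * a⁻¹ := by
  have hs : 1 ≤ √a := Real.one_le_sqrt.mpr ha
  have ht : 1 ≤ √c := Real.one_le_sqrt.mpr hc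
  have ea : a = √a ^ 2 := (Real.sq_sqrt (by linarith)).symm
  have ec : c = √c ^ 2 := (Real.sq_sqrt (by linarith)).symm
  generalize √a = s at *
  generalize √c = t at *
  subst ea ec
  have e1 : (s⁻¹ - t⁻¹) ^ 2 = (s - t) ^ 2 / (s ^ 2 * t ^ 2) := by
    field_simp
    ring
  have e2 : (s ^ 2 - t ^ 2) ^ 2 * (s ^ 2)⁻¹ = (s - t) ^ 2 * ((s + t) ^ 2 * t ^ 2) / (s ^ 2 * t ^ 2) := by
    field_simp
    ring
  rw [e1, e2]
  refine div_le_div_of_nonneg_right ?_ (by positivity)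
  refine le_mul_of_one_le_right (sq_nonneg _) ?_
  have : 1 ≤ (s + t) ^ 2 := one_le_pow₀ (by linarith)
  have h2 : 1 ≤ t ^ 2 := one_le_pow₀ ht
  exact one_le_mul_of_one_le_of_one_le this h2

/-- The weighted energy of `f` is finite. -/
lemma Geo.energy (hG : Geo b μ ρ w C) (o : X) {V : X → ℝ} {f h : X → ℂ} (hP : Pair b μ V f h)
    (hVW : ∀ x, - (w x) ≤ V x) :
    Summable fun z : X × X => b z.1 z.2 *
      ‖(((√(w z.1))⁻¹ : ℝ) : ℂ) * f z.1 - ((√(w z.2))⁻¹ : ℝ) * f z.2‖ ^ 2 := by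
  have hw0 : ∀ x, 0 < w x := fun x => by linarith [hG.w1 x]
  refine summable_of_sum_le (c := ∑' x, μ x * ‖h x‖ ^ 2 +
    (3 + (2 * C + 2)) * ∑' x, μ x * ‖f x‖ ^ 2)
    (fun z => mul_nonneg (hG.hb _ _) (sq_nonneg _)) fun S => ?_
  set θ : ℕ → X → ℝ := fun n x => eta ρ o ((n : ℝ) + 1) x * (√(w x))⁻¹ with hθ
  have hlim : Filter.Tendsto (fun n => ∑ z ∈ S, b z.1 z.2 *
      ‖(θ n z.1 : ℂ) * f z.1 - θ n z.2 * f z.2‖ ^ 2) Filter.atTop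
      (nhds (∑ z ∈ S, b z.1 z.2 *
        ‖(((√(w z.1))⁻¹ : ℝ) : ℂ) * f z.1 - ((√(w z.2))⁻¹ : ℝ) * f z.2‖ ^ 2)) := by
    have hθl : ∀ x, Filter.Tendsto (fun n => (θ n x : ℂ)) Filter.atTop
        (nhds (((√(w x))⁻¹ : ℝ) : ℂ)) := by
      intro x
      refine (Complex.continuous_ofReal.tendsto _).comp ?_
      simpa [hθ] using (eta_tendsto (ρ := ρ) o x).mul_const (√(w x))⁻¹
    refine tendsto_finsetSum _ fun z _ => ?_
    exact (((((hθl z.1).mul_const _).sub ((hθl z.2).mul_const _)).norm).pow 2).const_mul _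
  refine le_of_tendsto hlim (Filter.Eventually.of_forall fun n => ?_)
  have hN : (1:ℝ) ≤ (n : ℝ) + 1 := by have : (0:ℝ) ≤ n := Nat.cast_nonneg n; linarith
  have hψ2 : ∀ x, ((√(w x))⁻¹) ^ 2 = (w x)⁻¹ := fun x => by
    rw [inv_pow, Real.sq_sqrt (hw0 x).le]
  have hθ2 : ∀ x, θ n x ^ 2 = eta ρ o ((n : ℝ) + 1) x ^ 2 * (w x)⁻¹ := fun x => by
    simp only [hθ]; rw [mul_pow, hψ2]
  have hwi : ∀ x, (w x)⁻¹ ≤ 1 := fun x => inv_le_one_of_one_le₀ (hG.w1 x)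
  obtain ⟨K, hL⟩ := hG.loc o hN (fun x => θ n x ^ 2) (fun x => sq_nonneg _) (fun x => by
    rw [hθ2]; exact mul_le_of_le_one_right (sq_nonneg _) (hwi x))
  have hpt : ∀ x y, b x y * (θ n x - θ n y) ^ 2 ≤
      2 * (w x)⁻¹ * (b x y * (w x - w y) ^ 2) + 2 * (b x y * ρ x y ^ 2) := by
    intro x y
    have p1 := psi_lip (w x) (w y) (hG.w1 x) (hG.w1 y)
    have p2 := hG.eta_lip' o hN x y
    have p3 : (θ n x - θ n y) ^ 2 ≤ 2 * ((√(w x))⁻¹ - (√(w y))⁻¹) ^ 2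
        + 2 * (eta ρ o ((n : ℝ) + 1) x - eta ρ o ((n : ℝ) + 1) y) ^ 2 := by
      simp only [hθ]
      have q1 : eta ρ o ((n : ℝ) + 1) x ^ 2 ≤ 1 :=
        pow_le_one₀ (eta_nonneg _ _ _) (hG.eta_le_one o hN x)
      have q2 : ((√(w y))⁻¹) ^ 2 ≤ 1 := by rw [hψ2]; exact hwi y
      generalize eta ρ o ((n : ℝ) + 1) x = e1 at *
      generalize eta ρ o ((n : ℝ) + 1) y = e2 at *
      generalize (√(w x))⁻¹ = u at *
      generalize (√(w y))⁻¹ = v at *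
      have r1 : (e1 * u - e2 * v) ^ 2 ≤ 2 * (e1 ^ 2 * (u - v) ^ 2) + 2 * ((e1 - e2) ^ 2 * v ^ 2) := by
        nlinarith [sq_nonneg (e1 * (u - v) - (e1 - e2) * v)]
      have r2 := mul_le_of_le_one_left (sq_nonneg (u - v)) q1
      have r3 := mul_le_of_le_one_right (sq_nonneg (e1 - e2)) q2
      linarith
    have p4 : (θ n x - θ n y) ^ 2 ≤ 2 * ((w x - w y) ^ 2 * (w x)⁻¹) + 2 * ρ x y ^ 2 := by linarith
    have := mul_le_mul_of_nonneg_left p4 (hG.hb x y)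
    linarith
  have hsR : ∀ x, Summable fun y =>
      2 * (w x)⁻¹ * (b x y * (w x - w y) ^ 2) + 2 * (b x y * ρ x y ^ 2) := fun x =>
    ((hG.ws x).mul_left _).add ((hG.ρs x).mul_left _)
  have hgs : ∀ x, Summable fun y => b x y * (θ n x - θ n y) ^ 2 := fun x =>
    Summable.of_nonneg_of_le (fun y => mul_nonneg (hG.hb x y) (sq_nonneg _)) (hpt x) (hsR x)
  refine energy_cut (W := w) hG.hb hG.hsym hG.hbs hG.hμ hP hL hVW (fun x => ?_) hgs (fun x => ?_) S
  · rw [hθ2, mul_left_comm, mul_inv_cancel₀ (hw0 x).ne', mul_one]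
    exact pow_le_one₀ (eta_nonneg _ _ _) (hG.eta_le_one o hN x)
  · refine ((hgs x).tsum_le_tsum (hpt x) (hsR x)).trans ?_
    rw [Summable.tsum_add ((hG.ws x).mul_left _) ((hG.ρs x).mul_left _), tsum_mul_left,
      tsum_mul_left]
    have h1 : 0 ≤ 2 * (w x)⁻¹ := by have := hw0 x; positivity
    have h2 := mul_le_mul_of_nonneg_left (hG.wle x) h1
    have h3 : 2 * (w x)⁻¹ * (C * μ x * w x) = 2 * C * μ x := by
      have := (hw0 x).ne'
      field_simp
    have h4 := hG.ρle x
    linarith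

lemma phi_facts (a N : ℝ) (ha : 1 ≤ a) (hN : 1 ≤ N) :
    0 ≤ (1 + a / N)⁻¹ ∧ (1 + a / N)⁻¹ ≤ 1 ∧ ((1 + a / N)⁻¹) ^ 2 * a ≤ N := by
  have hN0 : 0 < N := by linarith
  have ha0 : 0 < a := by linarith
  have h1 : 1 ≤ 1 + a / N := by have : 0 ≤ a / N := by positivity
                                linarith
  refine ⟨by positivity, inv_le_one_of_one_le₀ h1, ?_⟩
  have e : ((1 + a / N)⁻¹) ^ 2 * a = N * ((a * N) / (N + a) ^ 2) := by
    field_simp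
  rw [e]
  refine mul_le_of_le_one_right hN0.le ?_
  rw [div_le_one (by positivity)]
  nlinarith [mul_pos ha0 hN0]

lemma theta_lip (e1 e2 a c N r : ℝ) (h1 : 0 ≤ e1) (h1' : e1 ≤ 1) (h2 : 0 ≤ e2) (h2' : e2 ≤ 1)
    (ha : 1 ≤ a) (hc : 1 ≤ c) (hN : 1 ≤ N) (hr : (e1 - e2) ^ 2 ≤ r ^ 2 / N ^ 2) :
    (e1 ^ 2 * (1 + a / N)⁻¹ - e2 ^ 2 * (1 + c / N)⁻¹) ^ 2 * c ≤
      2 / N * ((1 + a / N)⁻¹) ^ 2 * (a - c) ^ 2 + 8 / N * r ^ 2 := by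
  have hN0 : 0 < N := by linarith
  have ha0 : 0 < a := by linarith
  have hc0 : 0 < c := by linarith
  obtain ⟨p0, p1, p2⟩ := phi_facts a N ha hN
  obtain ⟨q0, q1, q2⟩ := phi_facts c N hc hN
  have ed : (1 + a / N)⁻¹ - (1 + c / N)⁻¹ = (c - a) / N * (1 + a / N)⁻¹ * (1 + c / N)⁻¹ := by
    field_simp
    ring
  generalize (1 + a / N)⁻¹ = p at *
  generalize (1 + c / N)⁻¹ = q at *
  have s1 : (e1 ^ 2 * p - e2 ^ 2 * q) ^ 2 ≤
      2 * (e1 ^ 4 * (p - q) ^ 2) + 2 * ((e1 ^ 2 - e2 ^ 2) ^ 2 * q ^ 2) := by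
    nlinarith [sq_nonneg (e1 ^ 2 * (p - q) - (e1 ^ 2 - e2 ^ 2) * q)]
  have s2 : e1 ^ 4 * (p - q) ^ 2 ≤ (p - q) ^ 2 :=
    mul_le_of_le_one_left (sq_nonneg _) (pow_le_one₀ h1 h1')
  have s3 : (e1 ^ 2 - e2 ^ 2) ^ 2 ≤ 4 * (e1 - e2) ^ 2 := by
    have : (e1 ^ 2 - e2 ^ 2) ^ 2 = (e1 + e2) ^ 2 * (e1 - e2) ^ 2 := by ring
    rw [this]
    refine mul_le_mul_of_nonneg_right ?_ (sq_nonneg _)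
    nlinarith
  have s4 : (p - q) ^ 2 * c ≤ 1 / N * p ^ 2 * (a - c) ^ 2 := by
    have : (p - q) ^ 2 * c = (a - c) ^ 2 * p ^ 2 / N ^ 2 * (q ^ 2 * c) := by
      rw [ed]; field_simp; ring
    rw [this]
    calc _ ≤ (a - c) ^ 2 * p ^ 2 / N ^ 2 * N := mul_le_mul_of_nonneg_left q2 (by positivity)
      _ = _ := by field_simp
  have s5 : (e1 ^ 2 - e2 ^ 2) ^ 2 * q ^ 2 * c ≤ 4 / N * r ^ 2 := by
    calc (e1 ^ 2 - e2 ^ 2) ^ 2 * q ^ 2 * c = (e1 ^ 2 - e2 ^ 2) ^ 2 * (q ^ 2 * c) := by ring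
      _ ≤ (4 * (r ^ 2 / N ^ 2)) * N := by
        refine mul_le_mul (s3.trans (by linarith)) q2 (by positivity) (by positivity)
      _ = _ := by field_simp
  have s6 := mul_le_mul_of_nonneg_right
    (s1.trans (add_le_add_left (mul_le_mul_of_nonneg_left s2 zero_le_two) _)) hc0.le
  have e8 : 8 / N * r ^ 2 = 2 * (4 / N * r ^ 2) := by ring
  have e2 : 2 / N * p ^ 2 * (a - c) ^ 2 = 2 * (1 / N * p ^ 2 * (a - c) ^ 2) := by ring
  rw [e8, e2]
  linarith

/-- The maximal operator is symmetric. -/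
theorem Geo.symmetric (hG : Geo b μ ρ w C) {V : X → ℝ} {f h g k : X → ℂ}
    (hP : Pair b μ V f h) (hQ : Pair b μ V g k) (hVW : ∀ x, - (w x) ≤ V x) :
    ∑' x, ((μ x : ℂ) * (star (h x) * g x - star (f x) * k x)) = 0 := by
  rcases isEmpty_or_nonempty X with hX | ⟨⟨o⟩⟩
  · simp
  have hw0 : ∀ x, 0 < w x := fun x => by linarith [hG.w1 x]
  have hEf := hG.energy o hP hVW
  have hEg := hG.energy o hQ hVW
  set E := (∑' z : X × X, b z.1 z.2 *
        ‖(((√(w z.1))⁻¹ : ℝ) : ℂ) * f z.1 - ((√(w z.2))⁻¹ : ℝ) * f z.2‖ ^ 2)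
      + ∑' z : X × X, b z.1 z.2 *
        ‖(((√(w z.1))⁻¹ : ℝ) : ℂ) * g z.1 - ((√(w z.2))⁻¹ : ℝ) * g z.2‖ ^ 2 with hE
  set Nn : ℕ → ℝ := fun n => (n : ℝ) + 1 with hNn
  have hN : ∀ n, 1 ≤ Nn n := fun n => by
    have : (0:ℝ) ≤ n := Nat.cast_nonneg n
    simp only [hNn]; linarith
  set φ : ℕ → X → ℝ := fun n x => (1 + w x / Nn n)⁻¹ with hφ
  have hφf := fun n x => phi_facts (w x) (Nn n) (hG.w1 x) (hN n)
  set Θ : ℕ → X → ℝ := fun n x => eta ρ o (Nn n) x ^ 2 * φ n x with hΘ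
  have hinv : Filter.Tendsto (fun n => (Nn n)⁻¹) Filter.atTop (nhds 0) := by
    simpa [hNn] using tendsto_one_div_add_atTop_nhds_zero_nat (𝕜 := ℝ)
  have hΘl : ∀ x, Filter.Tendsto (fun n => Θ n x) Filter.atTop (nhds 1) := by
    intro x
    have h1 : Filter.Tendsto (fun n => φ n x) Filter.atTop (nhds 1) := by
      have := ((hinv.const_mul (w x)).const_add 1).inv₀ (by simp)
      simpa [hφ, div_eq_mul_inv] using this
    have h2 := ((eta_tendsto (ρ := ρ) o x).pow 2).mul h1
    simpa [hΘ] using h2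
  have hΘ0 : ∀ n x, 0 ≤ Θ n x := fun n x => mul_nonneg (sq_nonneg _) (hφf n x).1
  have hΘη : ∀ n x, Θ n x ≤ eta ρ o (Nn n) x ^ 2 := fun n x =>
    mul_le_of_le_one_right (sq_nonneg _) (hφf n x).2.1
  have hΘ1 : ∀ n x, Θ n x ≤ 1 := fun n x =>
    (hΘη n x).trans (pow_le_one₀ (eta_nonneg _ _ _) (hG.eta_le_one o (hN n) x))
  set κ : ℕ → X → ℝ := fun n x => 2 * C * (φ n x ^ 2 * w x * (Nn n)⁻¹) + 8 * (Nn n)⁻¹ with hκ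
  have hNi : ∀ n, 0 ≤ (Nn n)⁻¹ := fun n => inv_nonneg.mpr (by linarith [hN n])
  have hNi1 : ∀ n, (Nn n)⁻¹ ≤ 1 := fun n => inv_le_one_of_one_le₀ (hN n)
  have hκ0 : ∀ n x, 0 ≤ κ n x := fun n x => by
    have := hG.C0
    have := hw0 x
    have := hNi n
    simp only [hκ]
    positivity
  have hκ1 : ∀ n x, κ n x ≤ 2 * C + 8 := fun n x => by
    have h1 : φ n x ^ 2 * w x * (Nn n)⁻¹ ≤ 1 := by
      rw [← div_eq_mul_inv]
      exact (div_le_one (by linarith [hN n])).mpr (hφf n x).2.2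
    have := mul_le_of_le_one_right (by linarith [hG.C0] : 0 ≤ 2 * C) h1
    have := hNi1 n
    simp only [hκ]
    linarith
  have hκl : ∀ x, Filter.Tendsto (fun n => κ n x) Filter.atTop (nhds 0) := by
    intro x
    have hu : Filter.Tendsto (fun n => (2 * C * w x + 8) * (Nn n)⁻¹) Filter.atTop (nhds 0) := by
      simpa using hinv.const_mul (2 * C * w x + 8)
    refine squeeze_zero (fun n => hκ0 n x) (fun n => ?_) hu
    have h1 : φ n x ^ 2 ≤ 1 := pow_le_one₀ (hφf n x).1 (hφf n x).2.1
    have h2 : 0 ≤ 2 * C * (w x * (Nn n)⁻¹) := by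
      have := hG.C0
      have := hw0 x
      have := hNi n
      positivity
    have := mul_le_of_le_one_left h2 h1
    simp only [hκ]
    linarith
  have hfg : Summable fun x => μ x * (‖f x‖ ^ 2 + ‖g x‖ ^ 2) := by
    simpa [mul_add] using hP.f2.add hQ.f2
  have hpos : ∀ x, 0 ≤ μ x * (‖f x‖ ^ 2 + ‖g x‖ ^ 2) := fun x =>
    mul_nonneg (hG.hμ x).le (by positivity)
  have hMb : ∀ n x, ‖(κ n x * μ x) * (‖f x‖ ^ 2 + ‖g x‖ ^ 2)‖ ≤
      (2 * C + 8) * (μ x * (‖f x‖ ^ 2 + ‖g x‖ ^ 2)) := by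
    intro n x
    rw [mul_assoc, Real.norm_of_nonneg (mul_nonneg (hκ0 n x) (hpos x))]
    exact mul_le_mul_of_nonneg_right (hκ1 n x) (hpos x)
  have hMs : ∀ n, Summable fun x => (κ n x * μ x) * (‖f x‖ ^ 2 + ‖g x‖ ^ 2) := fun n =>
    Summable.of_norm_bounded (hfg.mul_left (2 * C + 8)) (hMb n)
  have hMl : Filter.Tendsto (fun n => ∑' x, (κ n x * μ x) * (‖f x‖ ^ 2 + ‖g x‖ ^ 2))
      Filter.atTop (nhds 0) := by
    have := tendsto_tsum_of_dominated_convergence (𝓕 := Filter.atTop)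
      (f := fun n x => (κ n x * μ x) * (‖f x‖ ^ 2 + ‖g x‖ ^ 2)) (g := fun _ => (0:ℝ))
      (hfg.mul_left (2 * C + 8))
      (fun x => by simpa using ((hκl x).mul_const (μ x)).mul_const (‖f x‖ ^ 2 + ‖g x‖ ^ 2))
      (Filter.Eventually.of_forall fun n x => hMb n x)
    simpa using this
  -- the main term
  set q : X → ℂ := fun x => (μ x : ℂ) * (star (h x) * g x - star (f x) * k x) with hq
  have hqb : ∀ x, ‖q x‖ ≤ (μ x * ‖f x‖ ^ 2 + μ x * ‖h x‖ ^ 2) +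
      (μ x * ‖g x‖ ^ 2 + μ x * ‖k x‖ ^ 2) := by
    intro x
    have h6 : ‖star (h x) * g x - star (f x) * k x‖ ≤
        (‖f x‖ ^ 2 + ‖h x‖ ^ 2) + (‖g x‖ ^ 2 + ‖k x‖ ^ 2) := by
      refine (norm_sub_le _ _).trans ?_
      rw [norm_mul, norm_mul, norm_star, norm_star]
      nlinarith [sq_nonneg (‖h x‖ - ‖g x‖), sq_nonneg (‖f x‖ - ‖k x‖),
        sq_nonneg (‖h x‖), sq_nonneg (‖f x‖), sq_nonneg (‖g x‖), sq_nonneg (‖k x‖)]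
    rw [hq, norm_mul, Complex.norm_real, Real.norm_of_nonneg (hG.hμ x).le]
    have := mul_le_mul_of_nonneg_left h6 (hG.hμ x).le
    linarith
  have hSl : Filter.Tendsto (fun n => ∑' x, (Θ n x : ℂ) * q x) Filter.atTop
      (nhds (∑' x, q x)) := by
    refine tendsto_tsum_of_dominated_convergence ((hP.f2.add hP.h2).add (hQ.f2.add hQ.h2))
      (fun x => ?_) (Filter.Eventually.of_forall fun n x => ?_)
    · have := ((Complex.continuous_ofReal.tendsto _).comp (hΘl x)).mul_const (q x)
      simpa using this
    · rw [norm_mul, Complex.norm_real, Real.norm_of_nonneg (hΘ0 n x)]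
      exact (mul_le_of_le_one_left (norm_nonneg _) (hΘ1 n x)).trans (hqb x)
  have hest : ∀ δ : ℝ, 0 < δ → 2 * ‖∑' x, q x‖ ≤ δ / 2 * E := by
    intro δ hδ
    have l1 := hSl.norm.const_mul 2
    have l2 := (hMl.const_mul (1 / (2 * δ))).add_const (δ / 2 * E)
    rw [mul_zero, zero_add] at l2
    refine le_of_tendsto_of_tendsto' l1 l2 fun n => ?_
    obtain ⟨K, hL⟩ := hG.loc o (hN n) (Θ n) (hΘ0 n) (hΘη n)
    have hpt : ∀ x y, b x y * ((Θ n x - Θ n y) ^ 2 * w y) ≤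
        2 / Nn n * φ n x ^ 2 * (b x y * (w x - w y) ^ 2) + 8 / Nn n * (b x y * ρ x y ^ 2) := by
      intro x y
      have := theta_lip (eta ρ o (Nn n) x) (eta ρ o (Nn n) y) (w x) (w y) (Nn n) (ρ x y)
        (eta_nonneg _ _ _) (hG.eta_le_one o (hN n) x) (eta_nonneg _ _ _)
        (hG.eta_le_one o (hN n) y) (hG.w1 x) (hG.w1 y) (hN n) (hG.eta_lip o (hN n) x y)
      have := mul_le_mul_of_nonneg_left this (hG.hb x y)
      simp only [hΘ, hφ]
      linarith
    have hsR : ∀ x, Summable fun y =>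
        2 / Nn n * φ n x ^ 2 * (b x y * (w x - w y) ^ 2) + 8 / Nn n * (b x y * ρ x y ^ 2) :=
      fun x => ((hG.ws x).mul_left _).add ((hG.ρs x).mul_left _)
    have hgs : ∀ x, Summable fun y => b x y * ((Θ n x - Θ n y) ^ 2 * w y) := fun x =>
      Summable.of_nonneg_of_le
        (fun y => mul_nonneg (hG.hb x y) (mul_nonneg (sq_nonneg _) (hw0 y).le)) (hpt x) (hsR x)
    refine green_cut hG.hb hG.hsym hG.hbs hw0 hδ hP hQ hL hgs (fun x => ?_) (hMs n) hEf hEg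
    refine ((hgs x).tsum_le_tsum (hpt x) (hsR x)).trans ?_
    rw [Summable.tsum_add ((hG.ws x).mul_left _) ((hG.ρs x).mul_left _), tsum_mul_left,
      tsum_mul_left]
    have n0 : 0 < Nn n := by linarith [hN n]
    have h1 : 0 ≤ 2 / Nn n * φ n x ^ 2 := by positivity
    have h2 := mul_le_mul_of_nonneg_left (hG.wle x) h1
    have h3 := mul_le_mul_of_nonneg_left (hG.ρle x) (by positivity : 0 ≤ 8 / Nn n)
    refine (add_le_add h2 h3).trans (le_of_eq ?_)
    simp only [hκ]
    ring
  have hfin : 2 * ‖∑' x, q x‖ ≤ 0 := by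
    have hl : Filter.Tendsto (fun δ : ℝ => δ / 2 * E) (nhdsWithin 0 (Set.Ioi 0)) (nhds 0) := by
      have : Filter.Tendsto (fun δ : ℝ => δ / 2 * E) (nhds 0) (nhds (0 / 2 * E)) :=
        (Filter.tendsto_id.div_const 2).mul_const E
      simp only [zero_div, zero_mul] at this
      exact this.mono_left nhdsWithin_le_nhds
    exact ge_of_tendsto hl (Filter.eventually_of_mem self_mem_nhdsWithin fun δ hδ => hest δ hδ)
  have : ‖∑' x, q x‖ = 0 := le_antisymm (by linarith) (norm_nonneg _)
  exact norm_eq_zero.mp this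

lemma ennreal_summ {a : X → ℝ} {m : ℝ} (ha : ∀ y, 0 ≤ a y) (hm : 0 ≤ m)
    (h : ∑' y, ENNReal.ofReal (a y) ≤ ENNReal.ofReal m) : Summable a ∧ ∑' y, a y ≤ m := by
  have hs : Summable a := by
    have h1 : ∑' y, ENNReal.ofReal (a y) ≠ ∞ := ne_top_of_le_ne_top ENNReal.ofReal_ne_top h
    have := ENNReal.summable_toReal h1
    exact this.congr fun y => (ENNReal.toReal_ofReal (ha y))
  refine ⟨hs, ?_⟩
  rw [← ENNReal.ofReal_tsum_of_nonneg ha hs] at h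
  exact (ENNReal.ofReal_le_ofReal_iff hm).mp h

lemma fc_summ {b : X → X → ℝ} {μ : X → ℝ} (hb : ∀ x y, 0 ≤ b x y) (hμ : ∀ x, 0 < μ x)
    (hFC : ∀ x, Summable fun y => μ y * (b x y / μ y) ^ 2) {f : X → ℂ}
    (hf : Summable fun x => μ x * ‖f x‖ ^ 2) (x : X) : Summable fun y => (b x y : ℂ) * f y := by
  refine Summable.of_norm_bounded ((hFC x).add hf) fun y => ?_
  rw [norm_mul, Complex.norm_real, Real.norm_of_nonneg (hb x y)]
  have h1 : b x y = μ y * (b x y / μ y) := by have := (hμ y).ne'; field_simp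
  have h2 : b x y * ‖f y‖ = μ y * ((b x y / μ y) * ‖f y‖) := by
    rw [← mul_assoc, ← h1]
  rw [h2, ← mul_add]
  refine mul_le_mul_of_nonneg_left ?_ (hμ y).le
  nlinarith [sq_nonneg (b x y / μ y - ‖f y‖), sq_nonneg (b x y / μ y), sq_nonneg ‖f y‖]

end
end SchrAux

/-- Main theorem: Let `(X,b,μ)` be a connected weighted graph satisfying (FC),
admitting an intrinsic pseudo metric `ρ` satisfying condition (B*).  Let `V = U − W` with
`U, W ≥ 0`, and suppose `|∇W|²(x) ≤ c₁ + c₂·W(x)` for some constants `c₁, c₂ ≥ 0`.  Then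
`L_V` restricted to the finitely supported functions, viewed as a densely defined symmetric
operator in `ℓ²(X,μ)`, is essentially self-adjoint (its adjoint is self-adjoint).

The Hilbert space `ℓ²(X,μ)` is realised as `Lp ℂ 2 ν` for the weighted counting measure
`ν = ∑_x μ(x)·δ_x`; the operator `T` is required to have as domain exactly the (classes of)
finitely supported functions, on which it acts as `L_V`. -/
theorem schroedinger_essentially_selfAdjoint
    {X : Type*} [Countable X] [MeasurableSpace X] [MeasurableSingletonClass X]
    (b : X → X → ℝ) (μ : X → ℝ)
    (hb_symm : ∀ x y, b x y = b y x)
    (hb_nonneg : ∀ x y, 0 ≤ b x y)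
    (hb_loop : ∀ x, b x x = 0)
    (hb_sum : ∀ x, Summable fun z => b x z)
    (hμ_pos : ∀ x, 0 < μ x)
    (hconn : ∀ x y : X, Relation.ReflTransGen (fun a c => 0 < b a c) x y)
    (hFC : ∀ x, Summable fun y => μ y * (b x y / μ y) ^ 2)
    (ρ : X → X → ℝ)
    (hρ_nonneg : ∀ x y, 0 ≤ ρ x y)
    (hρ_symm : ∀ x y, ρ x y = ρ y x)
    (hρ_self : ∀ x, ρ x x = 0)
    (hρ_triangle : ∀ x y z, ρ x z ≤ ρ x y + ρ y z)
    (hρ_intrinsic : ∀ x, ∑' y, ENNReal.ofReal (b x y * ρ x y ^ 2) ≤ ENNReal.ofReal (μ x))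
    (hBstar : ∀ o : X, ∀ r : ℝ, 0 ≤ r →
      ∃ C : ℝ, ∀ y, ρ o y ≤ r → (μ y)⁻¹ * ∑' z, b y z ≤ C)
    (V U W : X → ℝ)
    (hU : ∀ x, 0 ≤ U x) (hW : ∀ x, 0 ≤ W x) (hV : ∀ x, V x = U x - W x)
    (c₁ c₂ : ℝ) (hc₁ : 0 ≤ c₁) (hc₂ : 0 ≤ c₂)
    (hgrad : ∀ x, (ENNReal.ofReal (μ x))⁻¹ * ∑' y, ENNReal.ofReal (b x y * (W x - W y) ^ 2) ≤
      ENNReal.ofReal (c₁ + c₂ * W x))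
    (ν : Measure X) (hν : ν = Measure.sum fun x => ENNReal.ofReal (μ x) • Measure.dirac x)
    (T : Lp ℂ 2 ν →ₗ.[ℂ] Lp ℂ 2 ν)
    (hdom : ∀ f : T.domain, ∃ u : X → ℂ, (Function.support u).Finite ∧
      ((f : Lp ℂ 2 ν) : X → ℂ) =ᵐ[ν] u)
    (hdom' : ∀ u : X → ℂ, (Function.support u).Finite →
      ∃ f : T.domain, ((f : Lp ℂ 2 ν) : X → ℂ) =ᵐ[ν] u)
    (hT : ∀ (f : T.domain) (u : X → ℂ), (Function.support u).Finite →
      ((f : Lp ℂ 2 ν) : X → ℂ) =ᵐ[ν] u →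
      ((T f : Lp ℂ 2 ν) : X → ℂ) =ᵐ[ν] lapV b μ V u) :
    IsSelfAdjoint T.adjoint := by
  classical
  have hcne : ∀ x, ENNReal.ofReal (μ x) ≠ ∞ := fun x => ENNReal.ofReal_ne_top
  -- null sets are empty
  have hae : ∀ {u v : X → ℂ}, u =ᵐ[ν] v → u = v := by
    intro u v huv
    ext x
    by_contra hne
    have h1 : ν {x} = 0 := measure_mono_null (by simpa using hne) (ae_iff.mp huv)
    have h2 : (ENNReal.ofReal (μ x) • Measure.dirac x : Measure X) {x} ≤ ν {x} := by
      rw [hν]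
      exact Measure.le_sum (fun x => ENNReal.ofReal (μ x) • Measure.dirac x) x {x}
    rw [h1] at h2
    have h3 := hμ_pos x
    simp at h2
    linarith
  have hinner : ∀ f g : Lp ℂ 2 ν, inner ℂ f g = ∑' x, (μ x : ℂ) * (star (f x) * g x) := by
    intro f g
    rw [L2.inner_def]
    have := integral_sum_dirac (f := fun a => inner ℂ (f a) (g a)) (x := fun x : X => x) hcne
    rw [← hν] at this
    rw [this]
    congr 1; ext x
    rw [ENNReal.toReal_ofReal (hμ_pos x).le, RCLike.inner_apply]
    simp [mul_comm]
  have hsq : ∀ f : Lp ℂ 2 ν, Summable fun x => μ x * ‖f x‖ ^ 2 := by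
    intro f
    have h1 := (memLp_two_iff_integrable_sq_norm (Lp.memLp f).1).mp (Lp.memLp f)
    have h2 : Integrable (fun x => ‖f x‖ ^ 2)
      (Measure.sum fun x => ENNReal.ofReal (μ x) • Measure.dirac ((fun x : X => x) x)) := by
      rw [← hν]; exact h1
    have h3 := (integrable_sum_dirac_iff hcne).mp h2
    refine h3.congr fun x => ?_
    rw [ENNReal.toReal_ofReal (hμ_pos x).le]
    simp
  have hfs : ∀ (f : Lp ℂ 2 ν) (x : X), Summable fun y => (b x y : ℂ) * f y := fun f x =>
    SchrAux.fc_summ hb_nonneg hμ_pos hFC (hsq f) x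
  have hμC : ∀ x, (μ x : ℂ) ≠ 0 := fun x => by exact_mod_cast (hμ_pos x).ne'
  have hbsC : ∀ x, Summable fun y => (b x y : ℂ) := fun x => Complex.summable_ofReal.mpr (hb_sum x)
  -- geometry
  have hG : SchrAux.Geo b μ ρ (fun x => 1 + W x) (c₁ + c₂) := by
    have hρ' := fun x => SchrAux.ennreal_summ
      (fun y => mul_nonneg (hb_nonneg x y) (sq_nonneg (ρ x y))) (hμ_pos x).le (hρ_intrinsic x)
    have hW' : ∀ x, (Summable fun y => b x y * (W x - W y) ^ 2) ∧
        ∑' y, b x y * (W x - W y) ^ 2 ≤ μ x * (c₁ + c₂ * W x) := by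
      intro x
      have h0 : 0 ≤ c₁ + c₂ * W x := add_nonneg hc₁ (mul_nonneg hc₂ (hW x))
      refine SchrAux.ennreal_summ (fun y => mul_nonneg (hb_nonneg x y) (sq_nonneg _))
        (mul_nonneg (hμ_pos x).le h0) ?_
      have h1 := hgrad x
      have h2 : ENNReal.ofReal (μ x) ≠ 0 := by simpa using hμ_pos x
      rw [ENNReal.ofReal_mul (hμ_pos x).le]
      calc _ = ENNReal.ofReal (μ x) * ((ENNReal.ofReal (μ x))⁻¹ *
            ∑' y, ENNReal.ofReal (b x y * (W x - W y) ^ 2)) := by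
            rw [← mul_assoc, ENNReal.mul_inv_cancel h2 (hcne x), one_mul]
        _ ≤ _ := mul_le_mul_right h1 _
    refine ⟨hb_nonneg, hb_symm, hb_sum, hμ_pos, hρ_nonneg, hρ_symm, hρ_triangle,
      fun x => (hρ' x).1, fun x => (hρ' x).2, hBstar, fun x => by linarith [hW x],
      add_nonneg hc₁ hc₂, fun x => ?_, fun x => ?_⟩
    · simpa using (hW' x).1
    · have h1 := (hW' x).2
      simp only [add_sub_add_left_eq_sub]
      refine h1.trans ?_
      have h2 : c₁ + c₂ * W x ≤ (c₁ + c₂) * (1 + W x) := by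
        nlinarith [mul_nonneg hc₁ (hW x)]
      have := mul_le_mul_of_nonneg_left h2 (hμ_pos x).le
      linarith
  have hVW : ∀ x, -(1 + W x) ≤ V x := fun x => by
    rw [hV]; linarith [hU x]
  have hsymm : ∀ f h g k : Lp ℂ 2 ν, SchrAux.Pair b μ V f h → SchrAux.Pair b μ V g k →
      inner ℂ h g = inner ℂ f k := by
    intro f h g k hP hQ
    have h0 := hG.symmetric hP hQ hVW
    have hs : ∀ u v : Lp ℂ 2 ν, Summable fun x => (μ x : ℂ) * (star (u x) * v x) := by
      intro u v
      refine Summable.of_norm_bounded ((hsq u).add (hsq v)) fun x => ?_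
      rw [norm_mul, norm_mul, norm_star, Complex.norm_real, Real.norm_of_nonneg (hμ_pos x).le,
        ← mul_add]
      refine mul_le_mul_of_nonneg_left ?_ (hμ_pos x).le
      nlinarith [sq_nonneg (‖u x‖ - ‖v x‖), sq_nonneg ‖u x‖, sq_nonneg ‖v x‖]
    simp only [mul_sub] at h0
    rw [Summable.tsum_sub (hs h g) (hs f k)] at h0
    rw [hinner, hinner]
    exact sub_eq_zero.mp h0
  -- pairs from `T`
  have hpT : ∀ f : T.domain, SchrAux.Pair b μ V (f : Lp ℂ 2 ν) (T f) := by
    intro f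
    obtain ⟨u, hu, hfu⟩ := hdom f
    have h1 := hae (hT f u hu hfu)
    have h2 := hae hfu
    refine ⟨hsq _, hsq _, hfs _, fun x => ?_⟩
    rw [h1, lapV, ← h2]
    have h3 : ∑' y, (b x y : ℂ) * ((f : Lp ℂ 2 ν) x - (f : Lp ℂ 2 ν) y)
        = ((∑' y, b x y : ℝ) : ℂ) * (f : Lp ℂ 2 ν) x - ∑' y, (b x y : ℂ) * (f : Lp ℂ 2 ν) y := by
      simp only [mul_sub]
      rw [Summable.tsum_sub ((hbsC x).mul_right _) (hfs _ x), tsum_mul_right, Complex.ofReal_tsum]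
    rw [h3, mul_add, ← mul_assoc, mul_inv_cancel₀ (hμC x)]
    ring
  -- delta functions
  have hdelta : ∀ x, ∃ d : T.domain, (∀ v : Lp ℂ 2 ν, inner ℂ v (d : Lp ℂ 2 ν)
        = (μ x : ℂ) * star (v x)) ∧ ∀ y, (μ y : ℂ) * (T d) y
        = (if y = x then (((∑' z, b x z : ℝ) : ℂ) + μ x * V x) else 0) - b x y := by
    intro x
    have hfin : (Function.support (fun y => if y = x then (1:ℂ) else 0)).Finite :=
      (Set.finite_singleton x).subset (by intro y hy; by_contra h; simp_all)
    obtain ⟨d, hd⟩ := hdom' _ hfin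
    have hd' := hae hd
    refine ⟨d, fun v => ?_, fun y => ?_⟩
    · rw [hinner, hd', tsum_eq_single x]
      · simp
      · intro y hy; simp [hy]
    · have h1 := (hpT d).eq y
      have h2 : ∑' z, (b y z : ℂ) * (d : Lp ℂ 2 ν) z = b x y := by
        rw [hd', tsum_eq_single x]
        · rw [hb_symm y x]; simp
        · intro z hz; simp [hz]
      rw [h1, h2, hd']
      by_cases hy : y = x
      · subst hy; simp only [if_true, one_mul]
      · simp [hy]
  -- density
  have hdense : Dense (T.domain : Set (Lp ℂ 2 ν)) := by
    rw [Submodule.dense_iff_topologicalClosure_eq_top, Submodule.topologicalClosure_eq_top_iff,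
      Submodule.eq_bot_iff]
    intro v hv
    rw [Submodule.mem_orthogonal'] at hv
    have h0 : ∀ x, v x = 0 := by
      intro x
      obtain ⟨d, hd, -⟩ := hdelta x
      have := hv d d.2
      rw [hd v] at this
      simpa [(hμ_pos x).ne'] using this
    rw [Lp.eq_zero_iff_ae_eq_zero]
    exact Filter.Eventually.of_forall h0
  have hadj := T.adjoint_isFormalAdjoint hdense
  -- pairs from the adjoint
  have hpA : ∀ f : T.adjoint.domain, SchrAux.Pair b μ V (f : Lp ℂ 2 ν) (T.adjoint f) := by
    intro f
    refine ⟨hsq _, hsq _, hfs _, fun x => ?_⟩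
    obtain ⟨d, hd, hTd⟩ := hdelta x
    have h1 : inner ℂ (T.adjoint f) (d : Lp ℂ 2 ν) = inner ℂ (f : Lp ℂ 2 ν) (T d) := hadj f d
    rw [hd, hinner] at h1
    have hs2 : Summable fun y => (b x y : ℂ) * star ((f : Lp ℂ 2 ν) y) := by
      refine (hfs f x).star.congr fun y => ?_
      simp [mul_comm]
    have h2 : ∀ y, (μ y : ℂ) * (star ((f : Lp ℂ 2 ν) y) * (T d) y)
        = (if y = x then star ((f : Lp ℂ 2 ν) x) * (((∑' z, b x z : ℝ) : ℂ) + μ x * V x) else 0)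
          - (b x y : ℂ) * star ((f : Lp ℂ 2 ν) y) := by
      intro y
      rw [mul_left_comm, hTd]
      by_cases hy : y = x
      · subst hy; simp; ring
      · simp [hy]; ring
    simp only [h2] at h1
    rw [Summable.tsum_sub (hasSum_ite_eq x _).summable hs2, tsum_ite_eq] at h1
    have h3 := congrArg star h1
    have r2 : ∑' y, (b x y : ℂ) * star ((f : Lp ℂ 2 ν) y)
        = star (∑' y, (b x y : ℂ) * (f : Lp ℂ 2 ν) y) := by
      rw [tsum_star]
      congr 1; ext y
      simp [mul_comm]
    rw [r2] at h3
    generalize (∑' z, b x z) = B at *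
    generalize (∑' y, (b x y : ℂ) * (f : Lp ℂ 2 ν) y) = Z at *
    simpa using h3
  -- conclusion
  have hTle : T ≤ T.adjoint := by
    refine LinearPMap.IsFormalAdjoint.le_adjoint hdense fun f g => ?_
    exact hsymm _ _ _ _ (hpT f) (hpT g)
  have hdense' : Dense (T.adjoint.domain : Set (Lp ℂ 2 ν)) := hdense.mono hTle.1
  rw [LinearPMap.isSelfAdjoint_def]
  apply le_antisymm
  · refine LinearPMap.IsFormalAdjoint.le_adjoint hdense fun f g => ?_
    have h1 := T.adjoint.adjoint_isFormalAdjoint hdense'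
    have h2 := h1.symm ⟨f, hTle.1 f.2⟩ g
    have h3 : T f = T.adjoint ⟨f, hTle.1 f.2⟩ := hTle.2 rfl
    rw [h3]
    exact h2
  · refine LinearPMap.IsFormalAdjoint.le_adjoint hdense' fun f g => ?_
    exact hsymm _ _ _ _ (hpA f) (hpA g)
end
end

section
/- Let (X,b,μ) be a connected weighted graph satisfying (FC). Assume there exists an intrinsic pseudo metric ρ for (X,b,μ) satisfying conditions (B*) and (J). Suppose V : X → ℝ satisfies: there exist o ∈ X and constants b₁ ≥ 0, b₂ ≥ 0 such that V(x) ≥ −b₁ − b₂·ρ(o,x)² for all x ∈ X. Then the operator L_V restricted to C_c(X), viewed as a densely defined symmetric operator in ℓ²(X,μ), is essentially self-adjoint. -/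
open MeasureTheory
open scoped ENNReal

noncomputable section

/-- Real-variable data of a weighted graph with an intrinsic metric; `r` is the distance to `o`. -/
structure GraphData {X : Type*} (b : X → X → ℝ) (μ : X → ℝ) (V : X → ℝ) (ρ : X → X → ℝ)
    (r : X → ℝ) (s b₁ b₂ : ℝ) : Prop where
  symm : ∀ x y, b x y = b y x
  nonneg : ∀ x y, 0 ≤ b x y
  bsum : ∀ x, Summable fun z => b x z
  mpos : ∀ x, 0 < μ x
  rsymm : ∀ x y, ρ x y = ρ y x
  rnonneg : ∀ x y, 0 ≤ ρ x y
  intr : ∀ x, Summable (fun y => b x y * ρ x y ^ 2)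
  intr_le : ∀ x, ∑' y, b x y * ρ x y ^ 2 ≤ μ x
  star : ∀ R : ℝ, ∃ C : ℝ, ∀ y, r y ≤ R → ∑' z, b y z ≤ C * μ y
  s0 : 0 ≤ s
  jump : ∀ x y, 0 < b x y → ρ x y ≤ s
  r0 : ∀ x, 0 ≤ r x
  lip : ∀ x y, |r x - r y| ≤ ρ x y
  hb1 : 0 ≤ b₁
  hb2 : 0 ≤ b₂
  hV : ∀ x, -b₁ - b₂ * r x ^ 2 ≤ V x

/-- `f` and `h` are square summable and `h` is the formal Schrödinger operator applied to `f`. -/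
structure LPair {X : Type*} (b : X → X → ℝ) (μ : X → ℝ) (V : X → ℝ) (f h : X → ℂ) : Prop where
  sf : Summable fun x => μ x * ‖f x‖ ^ 2
  sh : Summable fun x => μ x * ‖h x‖ ^ 2
  sb : ∀ x, Summable fun y => b x y * ‖f y‖
  eq : ∀ x, (μ x : ℂ) * h x = ∑' y, (b x y : ℂ) * (f x - f y) + (μ x : ℂ) * (V x : ℂ) * f x

theorem summable_weight {X : Type*} (c : X → X → ℝ) (a m : X → ℝ) (hc : ∀ x y, 0 ≤ c x y)
    (ha : ∀ x, 0 ≤ a x) (hs : ∀ x, Summable (c x)) (hm : Summable m)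
    (hle : ∀ x, (∑' y, c x y) * a x ≤ m x) :
    Summable fun p : X × X => c p.1 p.2 * a p.1 := by
  have h0 : (0 : X × X → ℝ) ≤ fun p : X × X => c p.1 p.2 * a p.1 :=
    fun p => mul_nonneg (hc p.1 p.2) (ha p.1)
  refine (summable_prod_of_nonneg h0).2 ⟨fun x => (hs x).mul_right (a x), ?_⟩
  simp only [tsum_mul_right]
  exact hm.of_nonneg_of_le (fun x => mul_nonneg (tsum_nonneg (hc x)) (ha x)) hle

section
variable {X : Type*} {b : X → X → ℝ} {μ V : X → ℝ} {ρ : X → X → ℝ} {r : X → ℝ} {s b₁ b₂ : ℝ}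

/-- the ball-localised density -/
def loc (r : X → ℝ) (R : ℝ) (f : X → ℂ) (x : X) : ℝ :=
  open Classical in if r x ≤ R then ‖f x‖ ^ 2 else 0

theorem loc_nonneg (R : ℝ) (f : X → ℂ) (x : X) : 0 ≤ loc r R f x := by
  unfold loc; split_ifs <;> positivity

theorem GraphData.sum_loc (G : GraphData b μ V ρ r s b₁ b₂) (R : ℝ) {f : X → ℂ}
    (hf : Summable fun x => μ x * ‖f x‖ ^ 2) :
    Summable fun p : X × X => b p.1 p.2 * loc r R f p.1 := by
  obtain ⟨C, hC⟩ := G.star R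
  refine summable_weight b (loc r R f) (fun x => |C| * (μ x * ‖f x‖ ^ 2)) G.nonneg
    (loc_nonneg R f) G.bsum (hf.mul_left _) ?_
  intro x
  have hm := (G.mpos x).le
  unfold loc
  split_ifs with h
  · have h1 := hC x h
    have h2 : ∑' z, b x z ≤ |C| * μ x :=
      h1.trans (mul_le_mul_of_nonneg_right (le_abs_self C) hm)
    rw [← mul_assoc]
    exact mul_le_mul_of_nonneg_right h2 (by positivity)
  · simp only [mul_zero]; positivity

theorem GraphData.sum_loc' (G : GraphData b μ V ρ r s b₁ b₂) (R : ℝ) {f : X → ℂ}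
    (hf : Summable fun x => μ x * ‖f x‖ ^ 2) :
    Summable fun p : X × X => b p.1 p.2 * loc r R f p.2 := by
  have := (Equiv.prodComm X X).summable_iff.2 (G.sum_loc R hf)
  refine this.congr fun p => ?_
  simp [G.symm p.1 p.2]

theorem GraphData.sum_rho (G : GraphData b μ V ρ r s b₁ b₂) {f : X → ℂ}
    (hf : Summable fun x => μ x * ‖f x‖ ^ 2) :
    Summable fun p : X × X => b p.1 p.2 * ρ p.1 p.2 ^ 2 * ‖f p.1‖ ^ 2 := by
  refine summable_weight (fun x y => b x y * ρ x y ^ 2) (fun x => ‖f x‖ ^ 2) _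
    (fun x y => mul_nonneg (G.nonneg x y) (sq_nonneg _)) (fun x => by positivity) G.intr hf ?_
  intro x
  exact mul_le_mul_of_nonneg_right (G.intr_le x) (by positivity)

theorem GraphData.sum_rho' (G : GraphData b μ V ρ r s b₁ b₂) {f : X → ℂ}
    (hf : Summable fun x => μ x * ‖f x‖ ^ 2) :
    Summable fun p : X × X => b p.1 p.2 * ρ p.1 p.2 ^ 2 * ‖f p.2‖ ^ 2 := by
  have := (Equiv.prodComm X X).summable_iff.2 (G.sum_rho hf)
  refine this.congr fun p => ?_
  simp [G.symm p.1 p.2, G.rsymm p.1 p.2]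

/-- Products of localised square summable functions are summable on edges. -/
theorem GraphData.edge_summable (G : GraphData b μ V ρ r s b₁ b₂) {f g : X → ℂ}
    (hf : Summable fun x => μ x * ‖f x‖ ^ 2) (hg : Summable fun x => μ x * ‖g x‖ ^ 2)
    {E : Type*} [NormedAddCommGroup E] [CompleteSpace E]
    (R : ℝ) (F : X × X → E)
    (h0 : ∀ p, R < r p.1 → F p = 0)
    (hF : ∀ p, ‖F p‖ ≤ b p.1 p.2 * (‖f p.1‖ ^ 2 + ‖f p.2‖ ^ 2 + ‖g p.1‖ ^ 2 + ‖g p.2‖ ^ 2)) :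
    Summable F := by
  refine Summable.of_norm_bounded
    ((((G.sum_loc (R + s) hf).add (G.sum_loc' (R + s) hf)).add (G.sum_loc (R + s) hg)).add
      (G.sum_loc' (R + s) hg)) ?_
  intro p
  have hn := G.nonneg p.1 p.2
  by_cases hp : R < r p.1
  · rw [h0 p hp, norm_zero]
    have h1 := loc_nonneg (r := r) (R + s) f p.1
    have h2 := loc_nonneg (r := r) (R + s) f p.2
    have h3 := loc_nonneg (r := r) (R + s) g p.1
    have h4 := loc_nonneg (r := r) (R + s) g p.2
    positivity
  · rcases hn.eq_or_lt with h | h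
    · have := hF p
      rw [← h] at this ⊢
      simpa using this
    · have h1 : r p.1 ≤ R + s := by linarith [G.s0]
      have h2 : r p.2 ≤ R + s := by
        have := (abs_le.1 (G.lip p.1 p.2)).1
        linarith [G.jump _ _ h]
      refine (hF p).trans (le_of_eq ?_)
      simp only [loc, h1, h2, if_true]
      ring

/-- cutoff -/
def eta (r : X → ℝ) (n : ℕ) (x : X) : ℝ := max 0 (1 - r x / (n + 1))

theorem eta_nonneg (n : ℕ) (x : X) : 0 ≤ eta r n x := le_max_left _ _

theorem GraphData.eta_le_one (G : GraphData b μ V ρ r s b₁ b₂) (n : ℕ) (x : X) :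
    eta r n x ≤ 1 := by
  have := G.r0 x
  refine max_le (by norm_num) ?_
  have : 0 ≤ r x / (n + 1) := by positivity
  linarith

theorem eta_zero (n : ℕ) (x : X) (h : (n : ℝ) + 1 < r x) : eta r n x = 0 := by
  refine max_eq_left ?_
  have : 1 ≤ r x / (n + 1) := by rw [le_div_iff₀ (by positivity)]; linarith
  linarith

theorem GraphData.eta_lip (G : GraphData b μ V ρ r s b₁ b₂) (n : ℕ) (x y : X) :
    |eta r n x - eta r n y| ≤ ρ x y / (n + 1) := by
  unfold eta
  rw [max_comm, max_comm 0]
  refine (abs_max_sub_max_le_abs _ _ _).trans ?_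
  have : 1 - r x / ((n : ℝ) + 1) - (1 - r y / (n + 1)) = (r y - r x) / (n + 1) := by ring
  rw [this, abs_div, abs_of_pos (by positivity : (0 : ℝ) < n + 1), abs_sub_comm]
  gcongr
  exact G.lip x y

theorem eta_tendsto (x : X) : Filter.Tendsto (fun n => eta r n x) Filter.atTop (nhds 1) := by
  have h : Filter.Tendsto (fun n : ℕ => r x / ((n : ℝ) + 1)) Filter.atTop (nhds 0) :=
    tendsto_const_nhds.div_atTop
      (Filter.tendsto_atTop_add_const_right _ _ tendsto_natCast_atTop_atTop)
  have := (tendsto_const_nhds (x := (0 : ℝ))).max ((tendsto_const_nhds (x := (1 : ℝ))).sub h)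
  simpa [eta] using this

/-- weight -/
def wt (r : X → ℝ) (x : X) : ℝ := (1 + r x)⁻¹

/-- Energy cutoff -/
def chi (r : X → ℝ) (n : ℕ) (x : X) : ℝ := eta r n x * wt r x

theorem GraphData.wt_pos (G : GraphData b μ V ρ r s b₁ b₂) (x : X) : 0 < wt r x := by
  have := G.r0 x
  unfold wt; positivity

theorem GraphData.wt_le (G : GraphData b μ V ρ r s b₁ b₂) (x : X) : wt r x ≤ 1 := by
  have := G.r0 x
  exact inv_le_one_of_one_le₀ (by linarith)

theorem GraphData.wt_r (G : GraphData b μ V ρ r s b₁ b₂) (x : X) : wt r x * r x ≤ 1 := by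
  have := G.r0 x
  unfold wt
  rw [inv_mul_le_iff₀ (by linarith)]; linarith

theorem GraphData.wt_lip (G : GraphData b μ V ρ r s b₁ b₂) (x y : X) :
    |wt r x - wt r y| ≤ ρ x y := by
  have hx := G.r0 x
  have hy := G.r0 y
  have : wt r x - wt r y = wt r x * wt r y * (r y - r x) := by
    unfold wt; field_simp; ring
  rw [this, abs_mul, abs_of_pos (mul_pos (G.wt_pos x) (G.wt_pos y)), abs_sub_comm]
  have h1 : wt r x * wt r y ≤ 1 := mul_le_one₀ (G.wt_le x) (G.wt_pos y).le (G.wt_le y)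
  exact (mul_le_of_le_one_left (abs_nonneg _) h1).trans (G.lip x y)

theorem GraphData.chi_lip (G : GraphData b μ V ρ r s b₁ b₂) (n : ℕ) (x y : X) :
    |chi r n x - chi r n y| ≤ 2 * ρ x y := by
  have : chi r n x - chi r n y = (eta r n x - eta r n y) * wt r x
      + eta r n y * (wt r x - wt r y) := by unfold chi; ring
  rw [this]
  refine (abs_add_le _ _).trans ?_
  rw [abs_mul, abs_mul, abs_of_pos (G.wt_pos x), abs_of_nonneg (eta_nonneg n y)]
  have h1 : |eta r n x - eta r n y| ≤ ρ x y :=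
    (G.eta_lip n x y).trans (div_le_self (G.rnonneg x y) (by linarith [n.cast_nonneg (α := ℝ)]))
  have h2 := mul_le_of_le_one_right (abs_nonneg (eta r n x - eta r n y)) (G.wt_le x)
  have h3 := mul_le_of_le_one_left (abs_nonneg (wt r x - wt r y)) (G.eta_le_one n y)
  linarith [G.wt_lip x y]

theorem GraphData.chi_nonneg (G : GraphData b μ V ρ r s b₁ b₂) (n : ℕ) (x : X) :
    0 ≤ chi r n x := mul_nonneg (eta_nonneg n x) (G.wt_pos x).le

theorem GraphData.chi_le_wt (G : GraphData b μ V ρ r s b₁ b₂) (n : ℕ) (x : X) :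
    chi r n x ≤ wt r x := mul_le_of_le_one_left (G.wt_pos x).le (G.eta_le_one n x)

theorem GraphData.chi_V (G : GraphData b μ V ρ r s b₁ b₂) (n : ℕ) (x : X) :
    -(chi r n x ^ 2 * V x) ≤ b₁ + b₂ := by
  have h0 := G.chi_nonneg n x
  have h1 := G.chi_le_wt n x
  have h2 : chi r n x ^ 2 ≤ 1 := pow_le_one₀ h0 (h1.trans (G.wt_le x))
  have h3 : chi r n x * r x ≤ 1 :=
    (mul_le_mul_of_nonneg_right h1 (G.r0 x)).trans (G.wt_r x)
  have h4 : (chi r n x * r x) ^ 2 ≤ 1 := pow_le_one₀ (mul_nonneg h0 (G.r0 x)) h3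
  have h5 := mul_le_mul_of_nonneg_left (G.hV x) (sq_nonneg (chi r n x))
  have h6 := mul_le_mul_of_nonneg_left h2 G.hb1
  have h7 := mul_le_mul_of_nonneg_left h4 G.hb2
  nlinarith

theorem two_mul_norm_le (a c : ℂ) : 2 * (‖a‖ * ‖c‖) ≤ ‖a‖ ^ 2 + ‖c‖ ^ 2 := by
  nlinarith [sq_nonneg (‖a‖ - ‖c‖)]

theorem LPair.summable_edge (G : GraphData b μ V ρ r s b₁ b₂) {f h : X → ℂ}
    (P : LPair b μ V f h) (x : X) : Summable fun y => (b x y : ℂ) * f y := by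
  refine Summable.of_norm ((P.sb x).congr fun y => ?_)
  rw [norm_mul, Complex.norm_real, Real.norm_of_nonneg (G.nonneg x y)]

theorem GraphData.summable_b (G : GraphData b μ V ρ r s b₁ b₂) (x : X) :
    Summable fun y => (b x y : ℂ) := Complex.summable_ofReal.2 (G.bsum x)

theorem energy (G : GraphData b μ V ρ r s b₁ b₂) {f h : X → ℂ} (P : LPair b μ V f h) :
    Summable fun p : X × X => b p.1 p.2 * ‖wt r p.1 * f p.1 - wt r p.2 * f p.2‖ ^ 2 := by
  set K0 : ℝ := ∑' x, (μ x * ‖h x‖ ^ 2 + μ x * ‖f x‖ ^ 2 + (b₁ + b₂) * (μ x * ‖f x‖ ^ 2)) with hK0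
  set K1 : ℝ := ∑' p : X × X, (2 * (b p.1 p.2 * ρ p.1 p.2 ^ 2 * ‖f p.1‖ ^ 2)
    + 2 * (b p.1 p.2 * ρ p.1 p.2 ^ 2 * ‖f p.2‖ ^ 2)) with hK1
  have key : ∀ (n : ℕ) (S : Finset (X × X)),
      ∑ p ∈ S, b p.1 p.2 * ‖chi r n p.1 * f p.1 - chi r n p.2 * f p.2‖ ^ 2 ≤ 2 * K0 + K1 := by
    intro n S
    let E : X × X → ℝ := fun p => chi r n p.1 ^ 2 *
      (b p.1 p.2 * ((f p.1 - f p.2) * (starRingEnd ℂ) (f p.1)).re)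
    have hE : Summable E := by
      refine G.edge_summable P.sf P.sf (n + 1) E ?_ ?_
      · intro p hp
        simp [E, chi, eta_zero n p.1 hp]
      · intro p
        have h1 : chi r n p.1 ^ 2 ≤ 1 :=
          pow_le_one₀ (G.chi_nonneg n _) ((G.chi_le_wt n _).trans (G.wt_le _))
        have h2 : ‖E p‖ ≤ b p.1 p.2 * |((f p.1 - f p.2) * (starRingEnd ℂ) (f p.1)).re| := by
          simp only [E, Real.norm_eq_abs, abs_mul, abs_of_nonneg (G.nonneg p.1 p.2),
            abs_of_nonneg (sq_nonneg (chi r n p.1))]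
          exact mul_le_of_le_one_left (mul_nonneg (G.nonneg _ _) (abs_nonneg _)) h1
        refine h2.trans (mul_le_mul_of_nonneg_left ?_ (G.nonneg _ _))
        refine (Complex.abs_re_le_norm _).trans ?_
        rw [norm_mul, Complex.norm_conj]
        have h3 := mul_le_mul_of_nonneg_right (norm_sub_le (f p.1) (f p.2)) (norm_nonneg (f p.1))
        have h4 := two_mul_norm_le (f p.2) (f p.1)
        nlinarith [sq_nonneg ‖f p.1‖, sq_nonneg ‖f p.2‖]
    have hEsum : ∑' p, E p ≤ K0 := by
      rw [hE.tsum_prod]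
      refine Summable.tsum_le_tsum (fun x => ?_) hE.prod
        ((P.sh.add P.sf).add (P.sf.mul_left _))
      have hre : ∑' y, b x y * ((f x - f y) * (starRingEnd ℂ) (f x)).re
          = μ x * (h x * (starRingEnd ℂ) (f x)).re - μ x * V x * ‖f x‖ ^ 2 := by
        have hs : Summable fun y => (b x y : ℂ) * (f x - f y) := by
          have := ((G.summable_b x).mul_right (f x)).sub (P.summable_edge G x)
          exact this.congr fun y => by ring
        have h1 : (μ x : ℂ) * (h x * (starRingEnd ℂ) (f x)) - μ x * V x * (f x * (starRingEnd ℂ) (f x))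
            = ∑' y, (b x y : ℂ) * (f x - f y) * (starRingEnd ℂ) (f x) := by
          rw [tsum_mul_right, ← mul_assoc, P.eq x]; ring
        have h2 := congrArg Complex.re h1
        rw [Complex.re_tsum (hs.mul_right _), Complex.mul_conj, Complex.normSq_eq_norm_sq] at h2
        simp only [mul_assoc, ← Complex.ofReal_mul, Complex.sub_re, Complex.re_ofReal_mul,
          Complex.ofReal_re] at h2
        rw [mul_assoc, h2]
      simp only [E]
      rw [tsum_mul_left, hre]
      have h1 : chi r n x ^ 2 ≤ 1 :=
        pow_le_one₀ (G.chi_nonneg n _) ((G.chi_le_wt n _).trans (G.wt_le _))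
      have h2 : (h x * (starRingEnd ℂ) (f x)).re ≤ ‖h x‖ * ‖f x‖ := by
        refine (Complex.re_le_norm _).trans ?_
        rw [norm_mul, Complex.norm_conj]
      have h3 := two_mul_norm_le (h x) (f x)
      have h4 : chi r n x ^ 2 * (h x * (starRingEnd ℂ) (f x)).re ≤ ‖h x‖ ^ 2 + ‖f x‖ ^ 2 := by
        have h5 := mul_le_mul_of_nonneg_left h2 (sq_nonneg (chi r n x))
        have h6 := mul_le_mul_of_nonneg_right h1 (mul_nonneg (norm_nonneg (h x)) (norm_nonneg (f x)))
        nlinarith [sq_nonneg ‖h x‖, sq_nonneg ‖f x‖]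
      have h7 := mul_le_mul_of_nonneg_right (G.chi_V n x) (sq_nonneg ‖f x‖)
      have h8 := mul_le_mul_of_nonneg_left (add_le_add h4 h7) (G.mpos x).le
      nlinarith
    have hE' : Summable (E ∘ Prod.swap) := (Equiv.prodComm X X).summable_iff.2 hE
    have hEs : ∑' p, (E ∘ Prod.swap) p = ∑' p, E p := (Equiv.prodComm X X).tsum_eq E
    have hR := ((G.sum_rho P.sf).mul_left 2).add ((G.sum_rho' P.sf).mul_left 2)
    have hpt : ∀ p : X × X, b p.1 p.2 * ‖chi r n p.1 * f p.1 - chi r n p.2 * f p.2‖ ^ 2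
        ≤ E p + (E ∘ Prod.swap) p + (2 * (b p.1 p.2 * ρ p.1 p.2 ^ 2 * ‖f p.1‖ ^ 2)
          + 2 * (b p.1 p.2 * ρ p.1 p.2 ^ 2 * ‖f p.2‖ ^ 2)) := by
      rintro ⟨x, y⟩
      simp only [E, Function.comp, Prod.swap, ← G.symm x y]
      have hid : ‖(chi r n x : ℂ) * f x - chi r n y * f y‖ ^ 2
          = chi r n x ^ 2 * ((f x - f y) * (starRingEnd ℂ) (f x)).re
            + chi r n y ^ 2 * ((f y - f x) * (starRingEnd ℂ) (f y)).re
            + (chi r n x - chi r n y) ^ 2 * (f x * (starRingEnd ℂ) (f y)).re := by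
        rw [Complex.sq_norm, Complex.normSq_apply]
        simp
        ring
      have h1 : (chi r n x - chi r n y) ^ 2 ≤ 4 * ρ x y ^ 2 := by
        have := sq_le_sq' (abs_le.1 (G.chi_lip n x y)).1 (abs_le.1 (G.chi_lip n x y)).2
        nlinarith
      have h2 : (f x * (starRingEnd ℂ) (f y)).re ≤ ‖f x‖ * ‖f y‖ := by
        refine (Complex.re_le_norm _).trans ?_
        rw [norm_mul, Complex.norm_conj]
      have h3 := two_mul_norm_le (f x) (f y)
      have h4 : (chi r n x - chi r n y) ^ 2 * (f x * (starRingEnd ℂ) (f y)).re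
          ≤ 4 * ρ x y ^ 2 * ((‖f x‖ ^ 2 + ‖f y‖ ^ 2) / 2) := by
        refine (mul_le_mul_of_nonneg_left (h2.trans (by linarith :
          _ ≤ (‖f x‖ ^ 2 + ‖f y‖ ^ 2) / 2)) (sq_nonneg _)).trans ?_
        exact mul_le_mul_of_nonneg_right h1 (by positivity)
      have h5 := mul_le_mul_of_nonneg_left h4 (G.nonneg x y)
      rw [hid]
      linarith
    have hS := (hE.add hE').add hR
    calc _ ≤ ∑ p ∈ S, _ := Finset.sum_le_sum fun p _ => hpt p
      _ ≤ ∑' p, _ := hS.sum_le_tsum S fun p _ => le_trans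
          (mul_nonneg (G.nonneg _ _) (sq_nonneg _)) (hpt p)
      _ = ∑' p, E p + ∑' p, (E ∘ Prod.swap) p + K1 := by
          rw [(hE.add hE').tsum_add hR, hE.tsum_add hE']
      _ ≤ 2 * K0 + K1 := by rw [hEs]; linarith
  refine summable_of_sum_le (c := 2 * K0 + K1)
    (fun p => mul_nonneg (G.nonneg _ _) (sq_nonneg _)) fun S => ?_
  refine le_of_tendsto' (x := Filter.atTop) (f := fun n : ℕ => ∑ p ∈ S,
    b p.1 p.2 * ‖(chi r n p.1 : ℂ) * f p.1 - chi r n p.2 * f p.2‖ ^ 2) ?_ (fun n => key n S)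
  refine tendsto_finsetSum _ fun p _ => ?_
  have hc : ∀ x, Filter.Tendsto (fun n => (chi r n x : ℂ)) Filter.atTop (nhds (wt r x : ℂ)) := by
    intro x
    refine (Complex.continuous_ofReal.tendsto _).comp ?_
    simpa [chi] using (eta_tendsto (r := r) x).mul_const (wt r x)
  exact (((((hc p.1).mul_const _).sub ((hc p.2).mul_const _)).norm.pow 2).const_mul _)

theorem green (G : GraphData b μ V ρ r s b₁ b₂) {f h g k : X → ℂ} (P : LPair b μ V f h)
    (Q : LPair b μ V g k) :
    ∑' x, (μ x : ℂ) * (h x * (starRingEnd ℂ) (g x) - f x * (starRingEnd ℂ) (k x)) = 0 := by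
  let D : X → ℂ := fun x => (μ x : ℂ) * (h x * (starRingEnd ℂ) (g x) - f x * (starRingEnd ℂ) (k x))
  let B : X × X → ℂ := fun p => (b p.1 p.2 : ℂ) *
    (f p.1 * (starRingEnd ℂ) (g p.2) - f p.2 * (starRingEnd ℂ) (g p.1))
  have hD : Summable fun x => ‖D x‖ := by
    refine Summable.of_nonneg_of_le (fun _ => norm_nonneg _) ?_
      (((P.sh.add Q.sf).add P.sf).add Q.sh)
    intro x
    have hm := (G.mpos x).le
    have h1 : ‖D x‖ ≤ μ x * (‖h x‖ * ‖g x‖ + ‖f x‖ * ‖k x‖) := by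
      simp only [D, norm_mul, Complex.norm_real, Real.norm_of_nonneg hm]
      refine mul_le_mul_of_nonneg_left ((norm_sub_le _ _).trans ?_) hm
      simp
    have h2 := two_mul_norm_le (h x) (g x)
    have h3 := two_mul_norm_le (f x) (k x)
    have h4 : ‖h x‖ * ‖g x‖ + ‖f x‖ * ‖k x‖ ≤ ‖h x‖ ^ 2 + ‖g x‖ ^ 2 + ‖f x‖ ^ 2 + ‖k x‖ ^ 2 := by
      nlinarith [sq_nonneg ‖h x‖, sq_nonneg ‖g x‖, sq_nonneg ‖f x‖, sq_nonneg ‖k x‖]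
    have h5 := mul_le_mul_of_nonneg_left h4 hm
    linarith
  have hDB : ∀ x, D x = ∑' y, B (x, y) := by
    intro x
    have hc := Q.summable_edge G x
    have hs1 : Summable fun y => (b x y : ℂ) * (f x - f y) := by
      have := ((G.summable_b x).mul_right (f x)).sub (P.summable_edge G x)
      exact this.congr fun y => by ring
    have hs2 : Summable fun y => (b x y : ℂ) * (g x - g y) := by
      have := ((G.summable_b x).mul_right (g x)).sub (Q.summable_edge G x)
      exact this.congr fun y => by ring
    have hs3 : Summable fun y => (starRingEnd ℂ) ((b x y : ℂ) * (g x - g y)) :=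
      Complex.conjCLE.summable.2 hs2
    have e2 := congrArg (starRingEnd ℂ) (Q.eq x)
    rw [map_add, Complex.conj_tsum] at e2
    have e1 := P.eq x
    simp only [D]
    have : (μ x : ℂ) * (h x * (starRingEnd ℂ) (g x) - f x * (starRingEnd ℂ) (k x))
      = (μ x * h x) * (starRingEnd ℂ) (g x) - f x * (starRingEnd ℂ) (μ x * k x) := by
      simp; ring
    rw [this, e1, e2]
    have h4 : (∑' y, (b x y : ℂ) * (f x - f y)) * (starRingEnd ℂ) (g x)
      - f x * ∑' y, (starRingEnd ℂ) ((b x y : ℂ) * (g x - g y)) = ∑' y, B (x, y) := by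
      rw [← tsum_mul_right, ← tsum_mul_left, ← (hs1.mul_right _).tsum_sub (hs3.mul_left _)]
      refine tsum_congr fun y => ?_
      simp [B]; ring
    rw [← h4]
    simp; ring
  have hsummable : ∀ n : ℕ, Summable fun p : X × X => (eta r n p.1 : ℂ) * B p := by
    intro n
    refine G.edge_summable P.sf Q.sf (n + 1) _ ?_ ?_
    · intro p hp
      simp [eta_zero n p.1 hp]
    · intro p
      have h1 : ‖(eta r n p.1 : ℂ) * B p‖ ≤ ‖B p‖ := by
        rw [norm_mul, Complex.norm_real, Real.norm_of_nonneg (eta_nonneg _ _)]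
        exact mul_le_of_le_one_left (norm_nonneg _) (G.eta_le_one _ _)
      refine h1.trans ?_
      simp only [B, norm_mul, Complex.norm_real, Real.norm_of_nonneg (G.nonneg p.1 p.2)]
      refine mul_le_mul_of_nonneg_left ((norm_sub_le _ _).trans ?_) (G.nonneg _ _)
      rw [norm_mul, norm_mul, Complex.norm_conj, Complex.norm_conj]
      have h2 := two_mul_norm_le (f p.1) (g p.2)
      have h3 := two_mul_norm_le (f p.2) (g p.1)
      nlinarith [sq_nonneg ‖f p.1‖, sq_nonneg ‖f p.2‖, sq_nonneg ‖g p.1‖, sq_nonneg ‖g p.2‖]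
  have hsymm : ∀ n : ℕ, 2 * ∑' x, (eta r n x : ℂ) * D x
      = ∑' p : X × X, ((eta r n p.1 - eta r n p.2 : ℝ) : ℂ) * B p := by
    intro n
    have h1 : ∑' x, (eta r n x : ℂ) * D x = ∑' p : X × X, (eta r n p.1 : ℂ) * B p := by
      rw [(hsummable n).tsum_prod]
      refine tsum_congr fun x => ?_
      rw [hDB]
      exact tsum_mul_left.symm
    have h2 : Summable ((fun p : X × X => (eta r n p.1 : ℂ) * B p) ∘ Prod.swap) :=
      (Equiv.prodComm X X).summable_iff.2 (hsummable n)
    have h3 : ∑' p, ((fun p : X × X => (eta r n p.1 : ℂ) * B p) ∘ Prod.swap) p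
      = ∑' p : X × X, (eta r n p.1 : ℂ) * B p := 
        (Equiv.prodComm X X).tsum_eq (fun p : X × X => (eta r n p.1 : ℂ) * B p)
    rw [h1, two_mul]
    nth_rewrite 2 [← h3]
    rw [← (hsummable n).tsum_add h2]
    refine tsum_congr fun p => ?_
    simp [B, G.symm p.2 p.1]; ring
  -- limit of the left side
  have hL : Filter.Tendsto (fun n => ∑' x, (eta r n x : ℂ) * D x) Filter.atTop
      (nhds (∑' x, D x)) := by
    refine tendsto_tsum_of_dominated_convergence hD (fun x => ?_) (Filter.Eventually.of_forall ?_)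
    · have := ((Complex.continuous_ofReal.tendsto _).comp (eta_tendsto (r := r) x)).mul_const (D x)
      simpa using this
    · intro n x
      rw [norm_mul, Complex.norm_real, Real.norm_of_nonneg (eta_nonneg _ _)]
      exact mul_le_of_le_one_left (norm_nonneg _) (G.eta_le_one _ _)
  -- limit of the right side
  have hdom : Summable fun p : X × X => (2 + s) *
      ((b p.1 p.2 * ‖wt r p.1 * f p.1 - wt r p.2 * f p.2‖ ^ 2
        + b p.1 p.2 * ρ p.1 p.2 ^ 2 * ‖g p.2‖ ^ 2)
       + (b p.1 p.2 * ‖wt r p.1 * g p.1 - wt r p.2 * g p.2‖ ^ 2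
        + b p.1 p.2 * ρ p.1 p.2 ^ 2 * ‖f p.2‖ ^ 2)) :=
    ((((energy G P).add (G.sum_rho' Q.sf)).add ((energy G Q).add (G.sum_rho' P.sf))).mul_left _)
  have hR : Filter.Tendsto (fun n => ∑' p : X × X, ((eta r n p.1 - eta r n p.2 : ℝ) : ℂ) * B p)
      Filter.atTop (nhds (∑' p : X × X, 0)) := by
    refine tendsto_tsum_of_dominated_convergence hdom (fun p => ?_) (Filter.Eventually.of_forall ?_)
    · have h1 := (eta_tendsto (r := r) p.1).sub (eta_tendsto (r := r) p.2)
      have := ((Complex.continuous_ofReal.tendsto _).comp h1).mul_const (B p)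
      simpa using this
    · rintro n ⟨x, y⟩
      have hn := G.nonneg x y
      simp only [B]
      rcases hn.eq_or_lt with hb | hb
      · simp [← hb]
      have hu : |eta r n x - eta r n y| * (1 + r x) ≤ (2 + s) * ρ x y := by
        have hl := G.eta_lip n x y
        by_cases hx : r x ≤ n + 1 + s
        · have h0 := G.r0 x
          have hN : (0 : ℝ) < n + 1 := by positivity
          have h3 : 1 + r x ≤ (2 + s) * (n + 1) := by
            have := mul_nonneg G.s0 (n.cast_nonneg (α := ℝ))
            nlinarith
          have h1 := mul_le_mul hl h3 (by linarith) (div_nonneg (G.rnonneg x y) hN.le)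
          refine h1.trans (le_of_eq ?_)
          field_simp
        · have h1 : eta r n x = 0 := eta_zero n x (by linarith [G.s0])
          have h2 : eta r n y = 0 := by
            refine eta_zero n y ?_
            have := (abs_le.1 (G.lip x y)).2
            linarith [G.jump _ _ hb]
          rw [h1, h2]
          simpa using mul_nonneg (by linarith [G.s0]) (G.rnonneg x y)
      have hwx : (1 + (r x : ℂ)) * (wt r x : ℂ) = 1 := by
        have := G.r0 x
        unfold wt
        rw [← Complex.ofReal_one, ← Complex.ofReal_add, ← Complex.ofReal_mul,
          mul_inv_cancel₀ (by linarith)]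
      have hwy : (1 + (r y : ℂ)) * (wt r y : ℂ) = 1 := by
        have := G.r0 y
        unfold wt
        rw [← Complex.ofReal_one, ← Complex.ofReal_add, ← Complex.ofReal_mul,
          mul_inv_cancel₀ (by linarith)]
      have hid : f x * (starRingEnd ℂ) (g y) - f y * (starRingEnd ℂ) (g x)
          = ((1 + r x : ℝ) : ℂ) * ((wt r x * f x - wt r y * f y) * (starRingEnd ℂ) (g y)
            - f y * (starRingEnd ℂ) (wt r x * g x - wt r y * g y)) := by
        simp only [map_sub, map_mul, Complex.conj_ofReal, Complex.ofReal_add, Complex.ofReal_one]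
        linear_combination (-(f x * (starRingEnd ℂ) (g y) - f y * (starRingEnd ℂ) (g x))) * hwx
      rw [hid]
      simp only [norm_mul, Complex.norm_real, Real.norm_eq_abs, abs_of_pos hb]
      rw [abs_of_nonneg (by linarith [G.r0 x] : 0 ≤ 1 + r x)]
      set A := ‖(wt r x : ℂ) * f x - wt r y * f y‖ with hA
      set A' := ‖(wt r x : ℂ) * g x - wt r y * g y‖ with hA'
      have h1 : ‖(wt r x * f x - wt r y * f y) * (starRingEnd ℂ) (g y)
            - f y * (starRingEnd ℂ) (wt r x * g x - wt r y * g y)‖ ≤ A * ‖g y‖ + ‖f y‖ * A' := by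
        refine (norm_sub_le _ _).trans ?_
        rw [norm_mul, norm_mul, Complex.norm_conj, Complex.norm_conj]
      have h2 := mul_le_mul hu h1 (norm_nonneg _)
        (mul_nonneg (by linarith [G.s0]) (G.rnonneg x y))
      have h3 := mul_le_mul_of_nonneg_left h2 hn
      have h4 : ρ x y * (A * ‖g y‖ + ‖f y‖ * A') ≤
          (A ^ 2 + ρ x y ^ 2 * ‖g y‖ ^ 2) + (A' ^ 2 + ρ x y ^ 2 * ‖f y‖ ^ 2) := by
        nlinarith [sq_nonneg (A - ρ x y * ‖g y‖), sq_nonneg (A' - ρ x y * ‖f y‖), sq_nonneg A,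
          sq_nonneg A', sq_nonneg (ρ x y * ‖g y‖), sq_nonneg (ρ x y * ‖f y‖)]
      have h5 := mul_le_mul_of_nonneg_left h4 (mul_nonneg (by linarith [G.s0] : 0 ≤ 2 + s) hn)
      linarith
  have h2 := hL.const_mul 2
  simp only [hsymm] at h2
  have := tendsto_nhds_unique h2 hR
  simpa using this

end

theorem summable_b_mul {X : Type*} {b : X → X → ℝ} {μ : X → ℝ} (hμ_pos : ∀ x, 0 < μ x)
    (hb_nonneg : ∀ x y, 0 ≤ b x y)
    (hFC : ∀ x, Summable fun y => μ y * (b x y / μ y) ^ 2) {f : X → ℂ}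
    (hf : Summable fun x => μ x * ‖f x‖ ^ 2) (x : X) : Summable fun y => b x y * ‖f y‖ := by
  refine Summable.of_nonneg_of_le (fun y => mul_nonneg (hb_nonneg x y) (norm_nonneg _)) ?_
    ((hFC x).add hf)
  intro y
  have hm := hμ_pos y
  have h1 : b x y = μ y * (b x y / μ y) := by field_simp
  set t := b x y / μ y
  rw [h1]
  have h2 : t * ‖f y‖ ≤ t ^ 2 + ‖f y‖ ^ 2 := by
    nlinarith [sq_nonneg (t - ‖f y‖), sq_nonneg (t + ‖f y‖)]
  nlinarith

section
variable {X : Type*} [Countable X] [MeasurableSpace X] [MeasurableSingletonClass X]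
  {μ : X → ℝ} {ν : Measure X}

theorem ae_eq_pt (hμ_pos : ∀ x, 0 < μ x)
    (hν : ν = Measure.sum fun x => ENNReal.ofReal (μ x) • Measure.dirac x)
    {f g : X → ℂ} (h : f =ᵐ[ν] g) (x : X) : f x = g x := by
  have h1 : ν {x} ≠ 0 := by
    have h2 : (ENNReal.ofReal (μ x) • Measure.dirac x) {x} ≤ ν {x} := by
      rw [hν]
      exact Measure.le_sum (fun x => ENNReal.ofReal (μ x) • Measure.dirac x) x {x}
    intro h3
    rw [h3] at h2
    simp at h2
    exact absurd (hμ_pos x) (not_lt.2 h2)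
  by_contra h4
  apply h1
  exact measure_mono_null (fun y hy => by rw [Set.mem_singleton_iff.1 hy]; exact h4) h

theorem lp_summable (hμ_pos : ∀ x, 0 < μ x)
    (hν : ν = Measure.sum fun x => ENNReal.ofReal (μ x) • Measure.dirac x)
    (f : Lp ℂ 2 ν) : Summable fun x => μ x * ‖f x‖ ^ 2 := by
  have h := L2.integrable_inner (𝕜 := ℂ) f f
  subst hν
  have h2 := h.summable_of_dirac
  refine h2.congr fun x => ?_
  rw [ENNReal.toReal_ofReal (hμ_pos x).le]
  simp [sq]

theorem lp_inner (hμ_pos : ∀ x, 0 < μ x)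
    (hν : ν = Measure.sum fun x => ENNReal.ofReal (μ x) • Measure.dirac x)
    (f g : Lp ℂ 2 ν) : inner ℂ f g = ∑' x, (μ x : ℂ) * (g x * (starRingEnd ℂ) (f x)) := by
  rw [L2.inner_def]
  subst hν
  rw [integral_sum_dirac (fun x => ENNReal.ofReal_ne_top)]
  refine tsum_congr fun x => ?_
  rw [ENNReal.toReal_ofReal (hμ_pos x).le]
  simp

theorem lp_inner_summable (hμ_pos : ∀ x, 0 < μ x)
    (hν : ν = Measure.sum fun x => ENNReal.ofReal (μ x) • Measure.dirac x)
    (f g : Lp ℂ 2 ν) : Summable fun x => (μ x : ℂ) * (g x * (starRingEnd ℂ) (f x)) := by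
  have h := L2.integrable_inner (𝕜 := ℂ) f g
  subst hν
  have h2 := h.summable_of_dirac
  refine Summable.of_norm (h2.congr fun x => ?_)
  rw [ENNReal.toReal_ofReal (hμ_pos x).le]
  simp [abs_of_pos (hμ_pos x)]

theorem lp_symm_of_pair {b : X → X → ℝ} {V : X → ℝ} {ρ : X → X → ℝ} {r : X → ℝ} {s b₁ b₂ : ℝ}
    (G : GraphData b μ V ρ r s b₁ b₂)
    (hν : ν = Measure.sum fun x => ENNReal.ofReal (μ x) • Measure.dirac x)
    {f h g k : Lp ℂ 2 ν} (P : LPair b μ V f h) (Q : LPair b μ V g k) :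
    inner ℂ k f = inner ℂ g h := by
  have h1 := green G P Q
  rw [lp_inner G.mpos hν, lp_inner G.mpos hν]
  have h2 := lp_inner_summable G.mpos hν g h
  have h3 := lp_inner_summable G.mpos hν k f
  simp only [mul_sub] at h1
  rw [h2.tsum_sub h3] at h1
  exact (sub_eq_zero.1 h1).symm

end

theorem lapV_single {X : Type*} [DecidableEq X] {b : X → X → ℝ} {μ V : X → ℝ}
    (hb_symm : ∀ x y, b x y = b y x) (hb_loop : ∀ x, b x x = 0)
    (hμ_pos : ∀ x, 0 < μ x) (x y : X) :
    (μ y : ℂ) * lapV b μ V (Pi.single x 1) y = -(b x y : ℂ)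
      + (if y = x then ((∑' z, b x z : ℝ) : ℂ) + μ x * V x else 0) := by
  have hm : (μ y : ℂ) ≠ 0 := by exact_mod_cast (hμ_pos y).ne'
  unfold lapV
  rw [mul_add, ← mul_assoc, mul_inv_cancel₀ hm, one_mul]
  by_cases h : y = x
  · subst h
    rw [if_pos rfl, hb_loop, Complex.ofReal_tsum]
    have : ∀ z, (b y z : ℂ) * ((Pi.single y 1 : X → ℂ) y - (Pi.single y 1 : X → ℂ) z) = b y z := by
      intro z
      by_cases hz : z = y
      · subst hz; simp [hb_loop]
      · simp [hz]
    simp only [this]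
    simp
  · rw [if_neg h, tsum_eq_single x]
    · simp [h, hb_symm x y]
    · intro z hz
      simp [h, hz]

/-- Corollary of the main theorem: Let `(X,b,μ)` be a connected weighted graph
satisfying (FC), admitting an intrinsic pseudo metric `ρ` satisfying conditions (B*) and (J)
(finite jump size `s`).  Suppose `V(x) ≥ −b₁ − b₂·ρ(o,x)²` for some `o ∈ X` and constants
`b₁, b₂ ≥ 0`.  Then `L_V` restricted to the finitely supported functions, viewed as a densely
defined symmetric operator in `ℓ²(X,μ)`, is essentially self-adjoint (its adjoint is
self-adjoint).

The Hilbert space `ℓ²(X,μ)` is realised as `Lp ℂ 2 ν` for the weighted counting measure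
`ν = ∑_x μ(x)·δ_x`; the operator `T` is required to have as domain exactly the (classes of)
finitely supported functions, on which it acts as `L_V`. -/
theorem schroedinger_essentially_selfAdjoint_quadratic
    {X : Type*} [Countable X] [MeasurableSpace X] [MeasurableSingletonClass X]
    (b : X → X → ℝ) (μ : X → ℝ)
    (hb_symm : ∀ x y, b x y = b y x)
    (hb_nonneg : ∀ x y, 0 ≤ b x y)
    (hb_loop : ∀ x, b x x = 0)
    (hb_sum : ∀ x, Summable fun z => b x z)
    (hμ_pos : ∀ x, 0 < μ x)
    (hconn : ∀ x y : X, Relation.ReflTransGen (fun a c => 0 < b a c) x y)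
    (hFC : ∀ x, Summable fun y => μ y * (b x y / μ y) ^ 2)
    (ρ : X → X → ℝ)
    (hρ_nonneg : ∀ x y, 0 ≤ ρ x y)
    (hρ_symm : ∀ x y, ρ x y = ρ y x)
    (hρ_self : ∀ x, ρ x x = 0)
    (hρ_triangle : ∀ x y z, ρ x z ≤ ρ x y + ρ y z)
    (hρ_intrinsic : ∀ x, ∑' y, ENNReal.ofReal (b x y * ρ x y ^ 2) ≤ ENNReal.ofReal (μ x))
    (hBstar : ∀ o : X, ∀ r : ℝ, 0 ≤ r →
      ∃ C : ℝ, ∀ y, ρ o y ≤ r → (μ y)⁻¹ * ∑' z, b y z ≤ C)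
    (hJ : ∃ s : ℝ, ∀ x y, 0 < b x y → ρ x y ≤ s)
    (V : X → ℝ) (o : X) (b₁ b₂ : ℝ) (hb₁ : 0 ≤ b₁) (hb₂ : 0 ≤ b₂)
    (hV : ∀ x, -b₁ - b₂ * ρ o x ^ 2 ≤ V x)
    (ν : Measure X) (hν : ν = Measure.sum fun x => ENNReal.ofReal (μ x) • Measure.dirac x)
    (T : Lp ℂ 2 ν →ₗ.[ℂ] Lp ℂ 2 ν)
    (hdom : ∀ f : T.domain, ∃ u : X → ℂ, (Function.support u).Finite ∧
      ((f : Lp ℂ 2 ν) : X → ℂ) =ᵐ[ν] u)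
    (hdom' : ∀ u : X → ℂ, (Function.support u).Finite →
      ∃ f : T.domain, ((f : Lp ℂ 2 ν) : X → ℂ) =ᵐ[ν] u)
    (hT : ∀ (f : T.domain) (u : X → ℂ), (Function.support u).Finite →
      ((f : Lp ℂ 2 ν) : X → ℂ) =ᵐ[ν] u →
      ((T f : Lp ℂ 2 ν) : X → ℂ) =ᵐ[ν] lapV b μ V u) :
    IsSelfAdjoint T.adjoint := by
  classical
  obtain ⟨s, hs⟩ := hJ
  have G : GraphData b μ V ρ (ρ o) (max s 0) b₁ b₂ := by
    have hi : ∀ x, Summable (fun y => b x y * ρ x y ^ 2) := by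
      intro x
      have h1 : ∑' y, ENNReal.ofReal (b x y * ρ x y ^ 2) ≠ ⊤ :=
        ((hρ_intrinsic x).trans_lt ENNReal.ofReal_lt_top).ne
      refine (ENNReal.summable_toReal h1).congr fun y => ?_
      exact ENNReal.toReal_ofReal (mul_nonneg (hb_nonneg x y) (sq_nonneg _))
    refine ⟨hb_symm, hb_nonneg, hb_sum, hμ_pos, hρ_symm, hρ_nonneg, hi, ?_, ?_, le_max_right _ _,
      fun x y h => (hs x y h).trans (le_max_left _ _), hρ_nonneg o, ?_, hb₁, hb₂, hV⟩
    · intro x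
      have h1 := hρ_intrinsic x
      rw [← ENNReal.ofReal_tsum_of_nonneg
        (fun y => mul_nonneg (hb_nonneg x y) (sq_nonneg _)) (hi x)] at h1
      exact (ENNReal.ofReal_le_ofReal_iff (hμ_pos x).le).1 h1
    · intro R
      obtain ⟨C, hC⟩ := hBstar o (max R 0) (le_max_right _ _)
      refine ⟨C, fun y hy => ?_⟩
      have h1 := hC y (hy.trans (le_max_left _ _))
      rw [inv_mul_le_iff₀ (hμ_pos y)] at h1
      linarith
    · intro x y
      have h1 := hρ_triangle o x y
      have h2 := hρ_triangle o y x
      rw [hρ_symm y x] at h2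
      rw [abs_le]; constructor <;> linarith
  -- delta functions in the domain
  have hsupp : ∀ x : X, (Function.support (Pi.single x (1 : ℂ))).Finite := fun x =>
    (Set.finite_singleton x).subset Pi.support_single_subset
  have hdelta : ∀ x : X, ∃ d : T.domain, (∀ y, (d : Lp ℂ 2 ν) y = (Pi.single x 1 : X → ℂ) y) ∧
      ∀ y, T d y = lapV b μ V (Pi.single x 1) y := by
    intro x
    obtain ⟨d, hd⟩ := hdom' (Pi.single x 1) (hsupp x)
    exact ⟨d, ae_eq_pt hμ_pos hν hd, ae_eq_pt hμ_pos hν (hT d _ (hsupp x) hd)⟩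
  choose d hd hTd using hdelta
  have hinner : ∀ (f : Lp ℂ 2 ν) (x : X),
      inner ℂ f (d x : Lp ℂ 2 ν) = (μ x : ℂ) * (starRingEnd ℂ) (f x) := by
    intro f x
    rw [lp_inner hμ_pos hν, tsum_eq_single x]
    · rw [hd]; simp
    · intro y hy
      rw [hd]; simp [hy]
  have hdense : Dense (T.domain : Set (Lp ℂ 2 ν)) := by
    rw [Submodule.dense_iff_topologicalClosure_eq_top, Submodule.topologicalClosure_eq_top_iff,
      Submodule.eq_bot_iff]
    intro f hf
    have h0 : ∀ x, f x = 0 := by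
      intro x
      have h1 := hinner f x
      rw [(Submodule.mem_orthogonal' _ _).1 hf _ (d x).2] at h1
      have hm : (μ x : ℂ) ≠ 0 := by exact_mod_cast (hμ_pos x).ne'
      simpa [hm] using h1.symm
    refine Lp.ext ?_
    filter_upwards [Lp.coeFn_zero ℂ 2 ν] with x hx
    rw [h0, hx]; rfl
  -- elements of the domain
  have pairT : ∀ f : T.domain, LPair b μ V (f : Lp ℂ 2 ν) (T f) := by
    intro f
    obtain ⟨u, hu, hfu⟩ := hdom f
    have h1 := ae_eq_pt hμ_pos hν hfu
    have h2 := ae_eq_pt hμ_pos hν (hT f u hu hfu)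
    have hsf := lp_summable hμ_pos hν (f : Lp ℂ 2 ν)
    refine ⟨hsf, lp_summable hμ_pos hν _, summable_b_mul hμ_pos hb_nonneg hFC hsf, fun x => ?_⟩
    have hm : (μ x : ℂ) ≠ 0 := by exact_mod_cast (hμ_pos x).ne'
    rw [h2 x]
    simp only [h1, lapV]
    rw [mul_add, ← mul_assoc, mul_inv_cancel₀ hm, one_mul, mul_assoc]
  have pairA : ∀ f : T.adjoint.domain, LPair b μ V (f : Lp ℂ 2 ν) (T.adjoint f) := by
    intro f
    have hsf := lp_summable hμ_pos hν (f : Lp ℂ 2 ν)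
    have hsb := summable_b_mul hμ_pos hb_nonneg hFC hsf
    refine ⟨hsf, lp_summable hμ_pos hν _, hsb, fun x => ?_⟩
    have hsc : Summable fun y => (b x y : ℂ) * (f : Lp ℂ 2 ν) y := by
      refine Summable.of_norm ((hsb x).congr fun y => ?_)
      rw [norm_mul, Complex.norm_real, Real.norm_of_nonneg (hb_nonneg x y)]
    have h1 := LinearPMap.adjoint_isFormalAdjoint hdense f (d x)
    rw [hinner, ← inner_conj_symm, lp_inner hμ_pos hν] at h1
    have h2 := congrArg (starRingEnd ℂ) h1
    rw [Complex.conj_conj] at h2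
    simp only [map_mul, Complex.conj_conj, Complex.conj_ofReal] at h2
    rw [h2]
    have hstep : ∀ y, (μ y : ℂ) * ((f : Lp ℂ 2 ν) y * (starRingEnd ℂ) (T (d x) y))
        = -((b x y : ℂ) * (f : Lp ℂ 2 ν) y) + (if y = x then
          (((∑' z, b x z : ℝ) : ℂ) + μ x * V x) * (f : Lp ℂ 2 ν) x else 0) := by
      intro y
      have h3 := congrArg (starRingEnd ℂ) (lapV_single (V := V) hb_symm hb_loop hμ_pos x y)
      rw [← hTd x y, map_mul, Complex.conj_ofReal] at h3
      have h4 : (μ y : ℂ) * ((f : Lp ℂ 2 ν) y * (starRingEnd ℂ) (T (d x) y))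
        = (μ y * (starRingEnd ℂ) (T (d x) y)) * (f : Lp ℂ 2 ν) y := by ring
      rw [h4, h3]
      by_cases hy : y = x
      · subst hy
        rw [if_pos rfl, if_pos rfl]
        simp only [map_add, map_neg, map_mul, Complex.conj_ofReal]
        ring
      · rw [if_neg hy, if_neg hy]
        simp
    simp only [hstep]
    have hs1 : Summable fun y => (if y = x then
          (((∑' z, b x z : ℝ) : ℂ) + μ x * V x) * (f : Lp ℂ 2 ν) x else 0) :=
      (hasSum_ite_eq x _).summable
    rw [hsc.neg.tsum_add hs1, tsum_ite_eq, tsum_neg]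
    simp only [mul_sub]
    rw [((G.summable_b x).mul_right _).tsum_sub hsc, tsum_mul_right, Complex.ofReal_tsum]
    ring
  have hTT : T.IsFormalAdjoint T := fun f g => lp_symm_of_pair G hν (pairT g) (pairT f)
  have hAA : T.adjoint.IsFormalAdjoint T.adjoint :=
    fun f g => lp_symm_of_pair G hν (pairA g) (pairA f)
  have hle : T ≤ T.adjoint := hTT.le_adjoint hdense
  have hdense' : Dense (T.adjoint.domain : Set (Lp ℂ 2 ν)) := hdense.mono hle.1
  rw [LinearPMap.isSelfAdjoint_def]
  refine le_antisymm ?_ (hAA.le_adjoint hdense')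
  refine LinearPMap.IsFormalAdjoint.le_adjoint hdense (LinearPMap.IsFormalAdjoint.symm ?_)
  intro f g
  have h1 := LinearPMap.adjoint_isFormalAdjoint hdense' f ⟨g, hle.1 g.2⟩
  rw [← hle.2 (x := g) (y := ⟨g, hle.1 g.2⟩) rfl] at h1
  exact h1
end
end

section
/- Let (X,b,μ) be a weighted graph, W : X → ℝ with W ≥ 0, and u ∈ C_c(X). Then 2·Re(∑_x μ(x)·(L₀u)(x)·conj(u(x))·(W(x)+1)) = ∑_{x,y} b(x,y)·|u(x)√(W(x)+1) − u(y)√(W(y)+1)|² − Re(∑_{x,y} b(x,y)·(√(W(x)+1) − √(W(y)+1))²·conj(u(x))·u(y)). -/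
noncomputable section

/-- The formal discrete Laplacian `(L₀ f)(x) = μ(x)⁻¹ ∑_y b(x,y)(f(x) − f(y))`. -/
def lap0 {X : Type*} (b : X → X → ℝ) (μ : X → ℝ) (f : X → ℂ) (x : X) : ℂ :=
  (μ x : ℂ)⁻¹ * ∑' y, (b x y : ℂ) * (f x - f y)

set_option maxHeartbeats 2000000

theorem summable_prod_aux {X : Type*} (f : X × X → ℂ) (S : Set X) (hS : S.Finite)
    (h0 : ∀ x, x ∉ S → ∀ y, f (x, y) = 0) (h1 : ∀ x, Summable fun y => f (x, y)) :
    Summable f := by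
  rw [← summable_norm_iff]
  rw [summable_prod_of_nonneg (fun p => norm_nonneg _)]
  refine ⟨fun x => (h1 x).norm, ?_⟩
  apply summable_of_hasFiniteSupport
  refine hS.subset ?_
  intro x hx
  by_contra hxS
  apply hx
  simp [h0 x hxS]

/-- Let `(X,b,μ)` be a weighted graph, `W : X → ℝ` with `W ≥ 0`, and
`u ∈ C_c(X)`.  Then
`2·Re(∑_x μ(x)(L₀u)(x) conj(u(x)) (W(x)+1))
  = ∑_{x,y} b(x,y)|u(x)√(W(x)+1) − u(y)√(W(y)+1)|²
    − Re(∑_{x,y} b(x,y)(√(W(x)+1) − √(W(y)+1))² conj(u(x)) u(y))`. -/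
theorem quadratic_form_identity {X : Type*} [Countable X]
    (b : X → X → ℝ) (μ : X → ℝ)
    (hb_symm : ∀ x y, b x y = b y x)
    (hb_nonneg : ∀ x y, 0 ≤ b x y)
    (hb_loop : ∀ x, b x x = 0)
    (hb_sum : ∀ x, Summable fun z => b x z)
    (hμ_pos : ∀ x, 0 < μ x)
    (W : X → ℝ) (hW : ∀ x, 0 ≤ W x)
    (u : X → ℂ) (hu : (Function.support u).Finite) :
    2 * (∑' x, (μ x : ℂ) * lap0 b μ u x * star (u x) * ((W x + 1 : ℝ) : ℂ)).re =
      (∑' p : X × X, b p.1 p.2 *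
          ‖u p.1 * (Real.sqrt (W p.1 + 1) : ℂ) - u p.2 * (Real.sqrt (W p.2 + 1) : ℂ)‖ ^ 2) -
        (∑' p : X × X, ((b p.1 p.2 *
            (Real.sqrt (W p.1 + 1) - Real.sqrt (W p.2 + 1)) ^ 2 : ℝ) : ℂ) *
          star (u p.1) * u p.2).re := by
  set H : X × X → ℂ := fun p => (b p.1 p.2 : ℂ) * (u p.1 - u p.2) * star (u p.1) *
    ((W p.1 + 1 : ℝ) : ℂ) with hH
  set K : X × X → ℂ := fun p => ((b p.1 p.2 *
            (Real.sqrt (W p.1 + 1) - Real.sqrt (W p.2 + 1)) ^ 2 : ℝ) : ℂ) *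
          star (u p.1) * u p.2 with hK
  have hrow : ∀ x, Summable fun y => (b x y : ℂ) * (u x - u y) := by
    intro x
    have e1 : Summable fun y => (b x y : ℂ) * u x :=
      (Complex.ofRealCLM.summable (hb_sum x)).mul_right (u x)
    have e2 : Summable fun y => (b x y : ℂ) * u y := by
      apply summable_of_hasFiniteSupport
      refine hu.subset ?_
      intro y hy h
      exact hy (by simp [h])
    exact (e1.sub e2).congr (fun y => by ring)
  have hHs : Summable H := by
    refine summable_prod_aux H _ hu ?_ ?_
    · intro x hx y
      have : u x = 0 := by simpa using hx
      simp [hH, this]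
    · intro x
      have e := ((hrow x).mul_right (star (u x))).mul_right (((W x + 1 : ℝ) : ℂ))
      simpa only [hH] using e
  have hKs : Summable K := by
    refine summable_prod_aux K _ hu ?_ ?_
    · intro x hx y
      have : u x = 0 := by simpa using hx
      simp [hK, this]
    · intro x
      apply summable_of_hasFiniteSupport
      refine hu.subset ?_
      intro y hy h
      exact hy (by simp [hK, h])
  have hL : (∑' x, (μ x : ℂ) * lap0 b μ u x * star (u x) * ((W x + 1 : ℝ) : ℂ))
      = ∑' p, H p := by
    rw [hHs.tsum_prod]
    refine tsum_congr fun x => ?_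
    have hm : (μ x : ℂ) ≠ 0 := by exact_mod_cast (hμ_pos x).ne'
    simp only [hH, lap0]
    rw [tsum_mul_right, tsum_mul_right, mul_inv_cancel_left₀ hm]
  have hHr : Summable fun p => (H p).re := Complex.reCLM.summable hHs
  have hKr : Summable fun p => (K p).re := Complex.reCLM.summable hKs
  have hHw : Summable fun p : X × X => (H p.swap).re :=
    (Equiv.prodComm X X).summable_iff.mpr hHr
  have hw : ∑' p : X × X, (H p.swap).re = ∑' p, (H p).re :=
    (Equiv.prodComm X X).tsum_eq (fun p => (H p).re)
  have hQ : ∀ p : X × X, b p.1 p.2 *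
          ‖u p.1 * (Real.sqrt (W p.1 + 1) : ℂ) - u p.2 * (Real.sqrt (W p.2 + 1) : ℂ)‖ ^ 2
      = (K p).re + ((H p).re + (H p.swap).re) := by
    rintro ⟨x, y⟩
    have hx : Real.sqrt (W x + 1) ^ 2 = W x + 1 := Real.sq_sqrt (by linarith [hW x])
    have hy : Real.sqrt (W y + 1) ^ 2 = W y + 1 := Real.sq_sqrt (by linarith [hW y])
    simp only [hH, hK, Prod.swap, hb_symm y x]
    rw [← Complex.normSq_eq_norm_sq, Complex.normSq_apply]
    generalize Real.sqrt (W x + 1) = s at hx ⊢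
    generalize Real.sqrt (W y + 1) = t at hy ⊢
    rw [← hx, ← hy]
    simp [-Complex.ofReal_mul, -Complex.ofReal_pow, -Complex.ofReal_sub, -Complex.ofReal_add]
    ring
  rw [hL, tsum_congr hQ, hKr.tsum_add (hHr.add hHw), hHr.tsum_add hHw, hw,
    Complex.re_tsum hHs, Complex.re_tsum hKs]
  ring
end
end

section
/- Let (X,b,μ) be a weighted graph, W : X → ℝ with W ≥ 0, and u ∈ C_c(X). Then 2·Re(∑_x μ(x)·(L₀u)(x)·conj(u(x))·(W(x)+1)) ≥ −∑_{x,y} b(x,y)·(√(W(x)+1) − √(W(y)+1))²·|u(x)|². -/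
open scoped ENNReal

noncomputable section

/-- Let `(X,b,μ)` be a weighted graph, `W : X → ℝ` with `W ≥ 0`, and
`u ∈ C_c(X)`.  Then
`2·Re(∑_x μ(x)(L₀u)(x) conj(u(x)) (W(x)+1))
  ≥ −∑_{x,y} b(x,y)(√(W(x)+1) − √(W(y)+1))² |u(x)|²`.
The possibly divergent nonnegative double sum on the right is computed in `ℝ≥0∞`; the
inequality is expressed as `ofReal` of minus the left-hand side being bounded by it. -/
theorem quadratic_form_lower_bound {X : Type*} [Countable X]
    (b : X → X → ℝ) (μ : X → ℝ)
    (hb_symm : ∀ x y, b x y = b y x)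
    (hb_nonneg : ∀ x y, 0 ≤ b x y)
    (hb_loop : ∀ x, b x x = 0)
    (hb_sum : ∀ x, Summable fun z => b x z)
    (hμ_pos : ∀ x, 0 < μ x)
    (W : X → ℝ) (hW : ∀ x, 0 ≤ W x)
    (u : X → ℂ) (hu : (Function.support u).Finite) :
    ENNReal.ofReal (-(2 * (∑' x, (μ x : ℂ) * lap0 b μ u x * star (u x) * ((W x + 1 : ℝ) : ℂ)).re)) ≤
      ∑' p : X × X, ENNReal.ofReal (b p.1 p.2 *
        (Real.sqrt (W p.1 + 1) - Real.sqrt (W p.2 + 1)) ^ 2 * ‖u p.1‖ ^ 2) := by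
  classical
  set F : Finset X := hu.toFinset with hF
  have hFu : ∀ x, x ∉ F → u x = 0 := by
    intro x hx
    by_contra h
    exact hx (by simp [hF, h])
  have hg : ∀ x, Real.sqrt (W x + 1) ^ 2 = W x + 1 := fun x =>
    Real.sq_sqrt (by linarith [hW x])
  set g : X → ℝ := fun x => Real.sqrt (W x + 1) with hgdef
  -- the real edge terms
  set A : X → X → ℝ := fun x y => b x y * ((u x - u y) * star (u x)).re * (g x) ^ 2 with hA
  -- summability of the Laplacian sums
  have hsum : ∀ x, Summable fun y => (b x y : ℂ) * (u x - u y) := by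
    intro x
    have h1 : Summable fun y => (b x y : ℂ) * u x :=
      (Complex.ofRealCLM.summable (hb_sum x)).mul_right (u x)
    have h2 : Summable fun y => (b x y : ℂ) * u y :=
      summable_of_ne_finset_zero (s := F) (fun y hy => by simp [hFu y hy])
    simpa [mul_sub] using h1.sub h2
  have hterm : ∀ x, HasSum (fun y => A x y)
      ((μ x : ℂ) * lap0 b μ u x * star (u x) * ((W x + 1 : ℝ) : ℂ)).re := by
    intro x
    have h := Complex.hasSum_re
      (((hsum x).hasSum.mul_right (star (u x))).mul_right ((W x + 1 : ℝ) : ℂ))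
    have hμ : (μ x : ℂ) ≠ 0 := by exact_mod_cast (hμ_pos x).ne'
    have e : (μ x : ℂ) * lap0 b μ u x = ∑' y, (b x y : ℂ) * (u x - u y) := by
      rw [lap0, mul_inv_cancel_left₀ hμ]
    rw [e]
    convert h using 1
    funext y
    simp only [hA, hgdef]
    rw [hg x, Complex.re_mul_ofReal, mul_assoc (b x y : ℂ), Complex.re_ofReal_mul]
  have hlow : ∀ x, ∑ y ∈ F, A x y ≤
      ((μ x : ℂ) * lap0 b μ u x * star (u x) * ((W x + 1 : ℝ) : ℂ)).re := by
    intro x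
    refine sum_le_hasSum F (fun y hy => ?_) (hterm x)
    simp only [hA, hFu y hy, sub_zero]
    have : (u x * star (u x)).re = ‖u x‖ ^ 2 := by
      have := Complex.mul_conj' (u x)
      rw [Complex.star_def, this]
      norm_cast
    rw [this]
    have := hb_nonneg x y
    positivity
  have htot : (∑' x, (μ x : ℂ) * lap0 b μ u x * star (u x) * ((W x + 1 : ℝ) : ℂ))
      = ∑ x ∈ F, (μ x : ℂ) * lap0 b μ u x * star (u x) * ((W x + 1 : ℝ) : ℂ) :=
    tsum_eq_sum (fun x hx => by simp [hFu x hx])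
  have hle : ∑ x ∈ F, ∑ y ∈ F, A x y ≤
      (∑' x, (μ x : ℂ) * lap0 b μ u x * star (u x) * ((W x + 1 : ℝ) : ℂ)).re := by
    rw [htot, Complex.re_sum]
    exact Finset.sum_le_sum (fun x _ => hlow x)
  set B : X → X → ℝ := fun x y => b x y * (g x - g y) ^ 2 * ‖u x‖ ^ 2 with hB
  have hB0 : ∀ x y, 0 ≤ B x y := fun x y => by
    have := hb_nonneg x y
    simp only [hB]; positivity
  have hpt : ∀ x y, 0 ≤ (A x y + A y x) + (B x y + B y x) / 2 := by
    intro x y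
    simp only [hA, hB, hb_symm y x, Complex.sq_norm, Complex.normSq_apply, Complex.star_def,
      Complex.mul_re, Complex.sub_re, Complex.sub_im, Complex.conj_re, Complex.conj_im]
    have key : 0 ≤ b x y * ((g x * (u x).re - g y * (u y).re) ^ 2
        + (g x * (u x).im - g y * (u y).im) ^ 2
        + (g x - g y) ^ 2 * (((u x).re - (u y).re) ^ 2 + ((u x).im - (u y).im) ^ 2) / 2) := by
      have := hb_nonneg x y
      positivity
    refine key.trans_eq ?_
    ring
  have hsw : ∀ C : X → X → ℝ, ∑ x ∈ F, ∑ y ∈ F, C y x = ∑ x ∈ F, ∑ y ∈ F, C x y :=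
    fun C => Finset.sum_comm
  have hfin : 0 ≤ 2 * (∑ x ∈ F, ∑ y ∈ F, A x y) + ∑ x ∈ F, ∑ y ∈ F, B x y := by
    have h : 0 ≤ ∑ x ∈ F, ∑ y ∈ F, ((A x y + A y x) + (B x y + B y x) / 2) :=
      Finset.sum_nonneg fun x _ => Finset.sum_nonneg fun y _ => hpt x y
    simp only [Finset.sum_add_distrib, ← Finset.sum_div] at h
    rw [hsw A, hsw B] at h
    linarith
  calc _ ≤ ENNReal.ofReal (∑ x ∈ F, ∑ y ∈ F, B x y) :=
        ENNReal.ofReal_le_ofReal (by linarith)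
    _ = ∑ p ∈ F ×ˢ F, ENNReal.ofReal (B p.1 p.2) := by
        rw [← Finset.sum_product', ENNReal.ofReal_sum_of_nonneg (fun p _ => hB0 p.1 p.2)]
    _ ≤ ∑' p : X × X, ENNReal.ofReal (B p.1 p.2) := ENNReal.sum_le_tsum _
end
end

section
/- Let (X,b,μ) be a weighted graph, W : X → ℝ with W ≥ 0, and suppose there are constants c₁ ≥ 0 and c₂ ≥ 0 with |∇W|²(x) ≤ c₁ + c₂·W(x) for all x ∈ X. Then for all u ∈ C_c(X): 2·Re(∑_x μ(x)·(L₀u)(x)·conj(u(x))·(W(x)+1)) ≥ −(c₁ + c₂)·∑_x μ(x)|u(x)|². -/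
open scoped ENNReal

noncomputable section

/-- The squared gradient `|∇W|²(x) = μ(x)⁻¹ ∑_y b(x,y)(W(x)−W(y))²`, computed in `ℝ≥0∞`. -/
def gradSq {X : Type*} (b : X → X → ℝ) (μ : X → ℝ) (W : X → ℝ) (x : X) : ℝ≥0∞ :=
  (ENNReal.ofReal (μ x))⁻¹ * ∑' y, ENNReal.ofReal (b x y * (W x - W y) ^ 2)

theorem qf_pair (a b c d V U : ℝ) (hV : 1 ≤ V) (hU : 1 ≤ U) :
    -((V - U) ^ 2 * (a ^ 2 + b ^ 2) / (2 * V)) - ((U - V) ^ 2 * (c ^ 2 + d ^ 2) / (2 * U)) ≤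
      V * ((a - c) * a + (b - d) * b) + U * ((c - a) * c + (d - b) * d) := by
  have key : ∀ p V t : ℝ, 1 ≤ V → ∀ q, -(V * p ^ 2 / 2) - t ^ 2 * q ^ 2 / (2 * V) ≤ t * p * q / 2 := by
    intro p V t hV q
    have : t * p * q / 2 + (V * p ^ 2 / 2) + t ^ 2 * q ^ 2 / (2 * V)
        = ((V * p + t * q / 2) ^ 2 + 3 / 4 * (t * q) ^ 2) / (2 * V) := by
      field_simp
      ring
    have h2 : 0 ≤ ((V * p + t * q / 2) ^ 2 + 3 / 4 * (t * q) ^ 2) / (2 * V) := by positivity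
    linarith
  have h1 := key (a - c) V (V - U) hV a
  have h2 := key (b - d) V (V - U) hV b
  have h3 := key (c - a) U (U - V) hU c
  have h4 := key (d - b) U (U - V) hU d
  have e1 : (V - U) ^ 2 * (a ^ 2 + b ^ 2) / (2 * V)
    = (V - U) ^ 2 * a ^ 2 / (2 * V) + (V - U) ^ 2 * b ^ 2 / (2 * V) := by ring
  have e2 : (U - V) ^ 2 * (c ^ 2 + d ^ 2) / (2 * U)
    = (U - V) ^ 2 * c ^ 2 / (2 * U) + (U - V) ^ 2 * d ^ 2 / (2 * U) := by ring
  rw [e1, e2]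
  linarith

/-- Let `(X,b,μ)` be a weighted graph, `W : X → ℝ` with `W ≥ 0`, and suppose
there are constants `c₁ ≥ 0` and `c₂ ≥ 0` with `|∇W|²(x) ≤ c₁ + c₂·W(x)` for all `x`.  Then
for all `u ∈ C_c(X)`:
`2·Re(∑_x μ(x)(L₀u)(x) conj(u(x)) (W(x)+1)) ≥ −(c₁+c₂)·∑_x μ(x)|u(x)|²`. -/
theorem quadratic_form_lower_bound_const {X : Type*} [Countable X]
    (b : X → X → ℝ) (μ : X → ℝ)
    (hb_symm : ∀ x y, b x y = b y x)
    (hb_nonneg : ∀ x y, 0 ≤ b x y)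
    (hb_loop : ∀ x, b x x = 0)
    (hb_sum : ∀ x, Summable fun z => b x z)
    (hμ_pos : ∀ x, 0 < μ x)
    (W : X → ℝ) (hW : ∀ x, 0 ≤ W x)
    (c₁ c₂ : ℝ) (hc₁ : 0 ≤ c₁) (hc₂ : 0 ≤ c₂)
    (hgrad : ∀ x, gradSq b μ W x ≤ ENNReal.ofReal (c₁ + c₂ * W x)) :
    ∀ u : X → ℂ, (Function.support u).Finite →
      -((c₁ + c₂) * ∑' x, μ x * ‖u x‖ ^ 2) ≤
        2 * (∑' x, (μ x : ℂ) * lap0 b μ u x * star (u x) * ((W x + 1 : ℝ) : ℂ)).re := by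
  intro u hu
  classical
  set F := hu.toFinset with hF
  have hnF : ∀ x, x ∉ F → u x = 0 := by
    intro x hx
    by_contra h
    exact hx (by simp [hF, h])
  have hV : ∀ x, 1 ≤ W x + 1 := fun x => by linarith [hW x]
  -- gradient bound on finite sums
  have hg : ∀ x, ∑ y ∈ F, b x y * (W x - W y) ^ 2 ≤ μ x * (c₁ + c₂ * W x) := by
    intro x
    have hc : 0 ≤ c₁ + c₂ * W x := by have := hW x; positivity
    have h := hgrad x
    unfold gradSq at h
    have hμ0 : ENNReal.ofReal (μ x) ≠ 0 := by simpa using hμ_pos x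
    rw [ENNReal.inv_mul_le_iff hμ0 ENNReal.ofReal_ne_top,
      ← ENNReal.ofReal_mul (hμ_pos x).le] at h
    have h2 := (ENNReal.sum_le_tsum F).trans h
    rw [← ENNReal.ofReal_sum_of_nonneg
      (fun y _ => mul_nonneg (hb_nonneg x y) (sq_nonneg _))] at h2
    exact (ENNReal.ofReal_le_ofReal_iff (mul_nonneg (hμ_pos x).le hc)).1 h2
  -- the sums are finite
  rw [tsum_eq_sum (s := F) (fun x hx => by simp [hnF x hx]),
    tsum_eq_sum (s := F) (fun x hx => by simp [hnF x hx]), Complex.re_sum]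
  let T : X → X → ℝ := fun x y => b x y * ((W x + 1) *
    (((u x).re - (u y).re) * (u x).re + ((u x).im - (u y).im) * (u x).im))
  let K : X → X → ℝ := fun x y => b x y * ((W x + 1 - (W y + 1)) ^ 2 *
    ((u x).re ^ 2 + (u x).im ^ 2) / (2 * (W x + 1)))
  have hT : ∀ x, ∑ y ∈ F, T x y ≤
      ((μ x : ℂ) * lap0 b μ u x * star (u x) * ((W x + 1 : ℝ) : ℂ)).re := by
    intro x
    have hs : Summable fun y => (b x y : ℂ) * (u x - u y) := by
      have s1 : Summable fun y => (b x y : ℂ) * u x :=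
        (Complex.summable_ofReal.2 (hb_sum x)).mul_right _
      have s2 : Summable fun y => (b x y : ℂ) * u y :=
        summable_of_ne_finset_zero (s := F) (fun y hy => by simp [hnF y hy])
      simpa [mul_sub] using s1.sub s2
    have hs2 := (hs.mul_right (star (u x))).mul_right ((W x + 1 : ℝ) : ℂ)
    have e : (μ x : ℂ) * lap0 b μ u x * star (u x) * ((W x + 1 : ℝ) : ℂ)
        = ∑' y, (b x y : ℂ) * (u x - u y) * star (u x) * ((W x + 1 : ℝ) : ℂ) := by
      have : (μ x : ℂ) ≠ 0 := by exact_mod_cast (hμ_pos x).ne'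
      rw [tsum_mul_right, tsum_mul_right, lap0, mul_inv_cancel_left₀ this]
    have e2 : ∀ y, ((b x y : ℂ) * (u x - u y) * star (u x) * ((W x + 1 : ℝ) : ℂ)).re
        = T x y := by
      intro y
      rw [Complex.re_mul_ofReal, mul_assoc, Complex.re_ofReal_mul]
      simp only [T, Complex.mul_re, Complex.sub_re, Complex.sub_im, Complex.star_def,
        Complex.conj_re, Complex.conj_im]
      ring
    rw [e, Complex.re_tsum hs2, tsum_congr e2]
    have hs3 : Summable (T x) := by
      have := (Complex.hasSum_re hs2.hasSum).summable
      exact this.congr (fun y => e2 y)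
    refine hs3.sum_le_tsum F (fun y hy => ?_)
    have := hV x
    have := hb_nonneg x y
    simp only [T, hnF y hy, Complex.zero_re, Complex.zero_im, sub_zero]
    have := mul_self_nonneg (u x).re
    have := mul_self_nonneg (u x).im
    positivity
  have hK : ∀ x, 2 * ∑ y ∈ F, K x y ≤ (c₁ + c₂) * (μ x * ‖u x‖ ^ 2) := by
    intro x
    have hn : ‖u x‖ ^ 2 = (u x).re ^ 2 + (u x).im ^ 2 := by
      rw [Complex.sq_norm, Complex.normSq_apply]; ring
    have hp : 0 < W x + 1 := by linarith [hV x]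
    have e : 2 * ∑ y ∈ F, K x y =
        (∑ y ∈ F, b x y * (W x - W y) ^ 2) * (‖u x‖ ^ 2 / (W x + 1)) := by
      rw [Finset.mul_sum, Finset.sum_mul]
      refine Finset.sum_congr rfl (fun y _ => ?_)
      simp only [K]
      rw [← hn]
      field_simp
      ring
    rw [e]
    have hle : ∑ y ∈ F, b x y * (W x - W y) ^ 2 ≤ μ x * ((c₁ + c₂) * (W x + 1)) := by
      refine (hg x).trans (mul_le_mul_of_nonneg_left ?_ (hμ_pos x).le)
      nlinarith [mul_nonneg hc₁ (hW x)]
    calc _ ≤ μ x * ((c₁ + c₂) * (W x + 1)) * (‖u x‖ ^ 2 / (W x + 1)) :=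
          mul_le_mul_of_nonneg_right hle (by positivity)
      _ = _ := by field_simp
  have hTK : ∀ x y, -(K x y) - K y x ≤ T x y + T y x := by
    intro x y
    have h := mul_le_mul_of_nonneg_left (qf_pair (u x).re (u x).im (u y).re (u y).im
      (W x + 1) (W y + 1) (hV x) (hV y)) (hb_nonneg x y)
    simp only [T, K, hb_symm y x]
    linarith
  have hsum : ∑ x ∈ F, ∑ y ∈ F, (-(K x y) - K y x) ≤ ∑ x ∈ F, ∑ y ∈ F, (T x y + T y x) :=
    Finset.sum_le_sum fun x _ => Finset.sum_le_sum fun y _ => hTK x y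
  simp only [Finset.sum_sub_distrib, Finset.sum_add_distrib, Finset.sum_neg_distrib] at hsum
  rw [Finset.sum_comm (f := fun x y => K y x), Finset.sum_comm (f := fun x y => T y x)] at hsum
  have h1 := Finset.sum_le_sum (s := F) fun x _ => hT x
  have h2 := Finset.sum_le_sum (s := F) fun x _ => hK x
  rw [← Finset.mul_sum, ← Finset.mul_sum] at h2
  linarith
end
end

section
/- Let (X,b,μ) be a weighted graph, W : X → ℝ, and u ∈ C_c(X). Then |Im(∑_x μ(x)·W(x)·u(x)·conj((L₀u)(x)))| ≤ (1/4)·∑_{x,y} b(x,y)·(W(x)−W(y))²·|u(y)|² + (1/2)·Re(∑_x μ(x)·(L₀u)(x)·conj(u(x))). -/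
open scoped ENNReal

noncomputable section

theorem lap0_mul_eq {X : Type*} (b : X → X → ℝ) (μ : X → ℝ)
    (hb_sum : ∀ x, Summable fun z => b x z) (hμ_pos : ∀ x, 0 < μ x)
    (u : X → ℂ) (S : Finset X) (hS : ∀ x, x ∉ S → u x = 0) (x : X) :
    (μ x : ℂ) * lap0 b μ u x =
      ((∑' y, b x y : ℝ) : ℂ) * u x - ∑ y ∈ S, (b x y : ℂ) * u y := by
  have hne : (μ x : ℂ) ≠ 0 := by exact_mod_cast (hμ_pos x).ne'
  have h1 : HasSum (fun y => (b x y : ℂ) * u x) (((∑' y, b x y : ℝ) : ℂ) * u x) :=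
    (Complex.hasSum_ofReal.2 (hb_sum x).hasSum).mul_right _
  have h2 : HasSum (fun y => (b x y : ℂ) * u y) (∑ y ∈ S, (b x y : ℂ) * u y) :=
    hasSum_sum_of_ne_finset_zero (fun y hy => by simp [hS y hy])
  have h3 := (h1.sub h2).tsum_eq
  rw [lap0, mul_inv_cancel_left₀ hne, ← h3]
  simp only [mul_sub]

theorem real_estimate {X : Type*} (b : X → X → ℝ)
    (hb_symm : ∀ x y, b x y = b y x)
    (hb_nonneg : ∀ x y, 0 ≤ b x y)
    (hb_sum : ∀ x, Summable fun z => b x z)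
    (W : X → ℝ) (u : X → ℂ) (S : Finset X) :
    |∑ x ∈ S, ∑ y ∈ S, b x y * (W x * ((u x).im * (u y).re - (u x).re * (u y).im))| -
      (1 / 2) * ∑ x ∈ S, ((∑' y, b x y) * ‖u x‖ ^ 2 -
        ∑ y ∈ S, b x y * ((u x).re * (u y).re + (u x).im * (u y).im)) ≤
      (1 / 4) * ∑ x ∈ S, ∑ y ∈ S, b x y * (W x - W y) ^ 2 * ‖u y‖ ^ 2 := by
  have hI : ∑ x ∈ S, ∑ y ∈ S, b x y * (W x * ((u x).im * (u y).re - (u x).re * (u y).im)) =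
      ∑ x ∈ S, ∑ y ∈ S, b x y * ((1 / 2) * (W x - W y) *
        ((u x).im * (u y).re - (u x).re * (u y).im)) := by
    have h := Finset.sum_comm (s := S) (t := S)
      (f := fun x y => b x y * (W x * ((u x).im * (u y).re - (u x).re * (u y).im)))
    have h2 : ∑ x ∈ S, ∑ y ∈ S, b x y * ((1 / 2) * (W x - W y) *
        ((u x).im * (u y).re - (u x).re * (u y).im)) =
        (1 / 2) * ∑ x ∈ S, ∑ y ∈ S,
          b x y * (W x * ((u x).im * (u y).re - (u x).re * (u y).im)) +
        (1 / 2) * ∑ y ∈ S, ∑ x ∈ S,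
          b x y * (W x * ((u x).im * (u y).re - (u x).re * (u y).im)) := by
      simp only [Finset.mul_sum, ← Finset.sum_add_distrib]
      refine Finset.sum_congr rfl fun x _ => Finset.sum_congr rfl fun y _ => ?_
      rw [hb_symm y x]
      ring
    rw [h2, ← h]
    ring
  have hE : ∑ x ∈ S, ∑ y ∈ S, b x y * ((1 / 2) * ‖u x - u y‖ ^ 2) ≤
      ∑ x ∈ S, ((∑' y, b x y) * ‖u x‖ ^ 2 -
        ∑ y ∈ S, b x y * ((u x).re * (u y).re + (u x).im * (u y).im)) := by
    have h := Finset.sum_comm (s := S) (t := S) (f := fun x y => b x y * ‖u x‖ ^ 2)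
    have h2 : ∑ x ∈ S, ∑ y ∈ S, b x y * ((1 / 2) * ‖u x - u y‖ ^ 2) =
        (1 / 2) * ∑ x ∈ S, ∑ y ∈ S, b x y * ‖u x‖ ^ 2 +
        (1 / 2) * ∑ y ∈ S, ∑ x ∈ S, b x y * ‖u x‖ ^ 2 -
        ∑ x ∈ S, ∑ y ∈ S, b x y * ((u x).re * (u y).re + (u x).im * (u y).im) := by
      simp only [Finset.mul_sum, ← Finset.sum_add_distrib, ← Finset.sum_sub_distrib]
      refine Finset.sum_congr rfl fun x _ => Finset.sum_congr rfl fun y _ => ?_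
      rw [hb_symm y x]
      simp only [Complex.sq_norm, Complex.normSq_apply, Complex.sub_re, Complex.sub_im]
      ring
    have h3 : ∑ x ∈ S, ∑ y ∈ S, b x y * ‖u x‖ ^ 2 ≤ ∑ x ∈ S, (∑' y, b x y) * ‖u x‖ ^ 2 := by
      refine Finset.sum_le_sum fun x _ => ?_
      rw [← Finset.sum_mul]
      exact mul_le_mul_of_nonneg_right
        ((hb_sum x).sum_le_tsum _ (fun y _ => hb_nonneg x y)) (by positivity)
    rw [Finset.sum_sub_distrib, h2]
    linarith
  have hA : |∑ x ∈ S, ∑ y ∈ S, b x y * ((1 / 2) * (W x - W y) *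
        ((u x).im * (u y).re - (u x).re * (u y).im))| ≤
      (1 / 4) * ∑ x ∈ S, ∑ y ∈ S, b x y * (W x - W y) ^ 2 * ‖u y‖ ^ 2 +
      (1 / 2) * ∑ x ∈ S, ∑ y ∈ S, b x y * ((1 / 2) * ‖u x - u y‖ ^ 2) := by
    simp only [Finset.mul_sum, ← Finset.sum_add_distrib]
    refine (Finset.abs_sum_le_sum_abs _ _).trans (Finset.sum_le_sum fun x _ => ?_)
    refine (Finset.abs_sum_le_sum_abs _ _).trans (Finset.sum_le_sum fun y _ => ?_)
    rw [abs_mul, abs_of_nonneg (hb_nonneg x y)]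
    have key : |(1 / 2) * (W x - W y) * ((u x).im * (u y).re - (u x).re * (u y).im)| ≤
        (1 / 4) * ((W x - W y) ^ 2 * ‖u y‖ ^ 2) + (1 / 4) * ‖u x - u y‖ ^ 2 := by
      simp only [Complex.sq_norm, Complex.normSq_apply, Complex.sub_re, Complex.sub_im]
      generalize W x - W y = w
      generalize (u x).re = a
      generalize (u x).im = c
      generalize (u y).re = p
      generalize (u y).im = q
      rw [abs_le]
      constructor
      · nlinarith [sq_nonneg (w * p + (c - q)), sq_nonneg (w * q - (a - p))]
      · nlinarith [sq_nonneg (w * p - (c - q)), sq_nonneg (w * q + (a - p))]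
    have := mul_le_mul_of_nonneg_left key (hb_nonneg x y)
    linarith
  rw [hI]
  linarith

/-- Let `(X,b,μ)` be a weighted graph, `W : X → ℝ`, and `u ∈ C_c(X)`.  Then
`|Im(∑_x μ(x) W(x) u(x) conj((L₀u)(x)))|
  ≤ (1/4)·∑_{x,y} b(x,y)(W(x)−W(y))²|u(y)|² + (1/2)·Re(∑_x μ(x)(L₀u)(x) conj(u(x)))`.
The nonnegative double sum is computed in `ℝ≥0∞` (so the bound is trivially true if it
diverges); the inequality is expressed by moving the real term to the left-hand side. -/
theorem im_estimate {X : Type*} [Countable X]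
    (b : X → X → ℝ) (μ : X → ℝ)
    (hb_symm : ∀ x y, b x y = b y x)
    (hb_nonneg : ∀ x y, 0 ≤ b x y)
    (hb_loop : ∀ x, b x x = 0)
    (hb_sum : ∀ x, Summable fun z => b x z)
    (hμ_pos : ∀ x, 0 < μ x)
    (W : X → ℝ)
    (u : X → ℂ) (hu : (Function.support u).Finite) :
    ENNReal.ofReal
        (|(∑' x, (μ x : ℂ) * (W x : ℂ) * u x * star (lap0 b μ u x)).im| -
          (1 / 2) * (∑' x, (μ x : ℂ) * lap0 b μ u x * star (u x)).re) ≤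
      (1 / 4 : ℝ≥0∞) *
        ∑' p : X × X, ENNReal.ofReal (b p.1 p.2 * (W p.1 - W p.2) ^ 2 * ‖u p.2‖ ^ 2) := by
  classical
  set S := hu.toFinset with hSdef
  have hS : ∀ x, x ∉ S → u x = 0 := by
    intro x hx
    simpa [hSdef] using hx
  have hL := lap0_mul_eq b μ hb_sum hμ_pos u S hS
  have e1 : (∑' x, (μ x : ℂ) * (W x : ℂ) * u x * star (lap0 b μ u x)).im =
      ∑ x ∈ S, ∑ y ∈ S, b x y * ((-W x) * ((u x).im * (u y).re - (u x).re * (u y).im)) := by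
    rw [tsum_eq_sum (s := S) (fun x hx => by simp [hS x hx]), Complex.im_sum]
    refine Finset.sum_congr rfl fun x _ => ?_
    have : (μ x : ℂ) * (W x : ℂ) * u x * star (lap0 b μ u x) =
        (W x : ℂ) * u x * star ((μ x : ℂ) * lap0 b μ u x) := by
      simp only [star_mul', Complex.star_def, Complex.conj_ofReal]
      ring
    rw [this, hL, star_sub, star_sum, mul_sub, Complex.sub_im, Finset.mul_sum, Complex.im_sum]
    have h0 : ((W x : ℂ) * u x * star (((∑' y, b x y : ℝ) : ℂ) * u x)).im = 0 := by
      generalize (∑' y, b x y) = d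
      simp
      ring
    rw [h0, zero_sub, ← Finset.sum_neg_distrib]
    refine Finset.sum_congr rfl fun y _ => ?_
    simp
    ring
  have e2 : (∑' x, (μ x : ℂ) * lap0 b μ u x * star (u x)).re =
      ∑ x ∈ S, ((∑' y, b x y) * ‖u x‖ ^ 2 -
        ∑ y ∈ S, b x y * ((u x).re * (u y).re + (u x).im * (u y).im)) := by
    rw [tsum_eq_sum (s := S) (fun x hx => by simp [hS x hx]), Complex.re_sum]
    refine Finset.sum_congr rfl fun x _ => ?_
    rw [hL, sub_mul, Complex.sub_re, Finset.sum_mul, Complex.re_sum]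
    congr 1
    · generalize (∑' y, b x y) = d
      simp [Complex.sq_norm, Complex.normSq_apply]
      ring
    · refine Finset.sum_congr rfl fun y _ => ?_
      simp
      ring
  have hmain := real_estimate b hb_symm hb_nonneg hb_sum (fun x => -W x) u S
  rw [e1, e2]
  have hq : ENNReal.ofReal (1 / 4) = 1 / 4 := by
    rw [ENNReal.ofReal_div_of_pos (by norm_num)]
    simp
  refine (ENNReal.ofReal_le_ofReal hmain).trans ?_
  rw [ENNReal.ofReal_mul (by norm_num), hq, ← Finset.sum_product',
    ENNReal.ofReal_sum_of_nonneg (fun p _ =>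
      mul_nonneg (mul_nonneg (hb_nonneg _ _) (sq_nonneg _)) (sq_nonneg _))]
  gcongr
  refine le_trans (le_of_eq ?_) (ENNReal.sum_le_tsum (S ×ˢ S))
  refine Finset.sum_congr rfl fun p _ => ?_
  congr 3
  ring
end
end

section
/- Let (X,b,μ) be a weighted graph, ρ an intrinsic pseudo metric for (X,b,μ) whose jump size is at most s (i.e., ρ(x,y) ≤ s whenever b(x,y) > 0), o ∈ X, and b₁, b₂ ≥ 0 constants. Define W(x) = b₁ + b₂·(ρ(o,x)+s)². Then for all x ∈ X: |∇W|²(x) ≤ 9·b₂²·(ρ(o,x)+s)², and in particular |∇W|²(x) ≤ 9·b₂·W(x). -/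
open scoped ENNReal

noncomputable section

/-- Let `(X,b,μ)` be a weighted graph, `ρ` an intrinsic pseudo metric for
`(X,b,μ)` whose jump size is at most `s` (i.e. `ρ(x,y) ≤ s` whenever `b(x,y) > 0`), `o ∈ X`,
and `b₁, b₂ ≥ 0` constants.  Define `W(x) = b₁ + b₂·(ρ(o,x)+s)²`.  Then for all `x ∈ X`:
`|∇W|²(x) ≤ 9·b₂²·(ρ(o,x)+s)²`, and in particular `|∇W|²(x) ≤ 9·b₂·W(x)`. -/
theorem gradSq_W_le {X : Type*} [Countable X]
    (b : X → X → ℝ) (μ : X → ℝ)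
    (hb_symm : ∀ x y, b x y = b y x)
    (hb_nonneg : ∀ x y, 0 ≤ b x y)
    (hb_loop : ∀ x, b x x = 0)
    (hb_sum : ∀ x, Summable fun y => b x y)
    (hμ_pos : ∀ x, 0 < μ x)
    (ρ : X → X → ℝ)
    (hρ_nonneg : ∀ x y, 0 ≤ ρ x y)
    (hρ_symm : ∀ x y, ρ x y = ρ y x)
    (hρ_self : ∀ x, ρ x x = 0)
    (hρ_triangle : ∀ x y z, ρ x z ≤ ρ x y + ρ y z)
    (hρ_intrinsic : ∀ x, ∑' y, ENNReal.ofReal (b x y * ρ x y ^ 2) ≤ ENNReal.ofReal (μ x))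
    (s : ℝ) (hs : 0 ≤ s)
    (hρ_jump : ∀ x y, 0 < b x y → ρ x y ≤ s)
    (o : X) (b₁ b₂ : ℝ) (hb₁ : 0 ≤ b₁) (hb₂ : 0 ≤ b₂)
    (W : X → ℝ) (hW : ∀ x, W x = b₁ + b₂ * (ρ o x + s) ^ 2) :
    ∀ x, gradSq b μ W x ≤ ENNReal.ofReal (9 * b₂ ^ 2 * (ρ o x + s) ^ 2) ∧
      gradSq b μ W x ≤ ENNReal.ofReal (9 * b₂ * W x) := by
  intro x
  have hterm : ∀ y, b x y * (W x - W y) ^ 2 ≤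
      (9 * b₂ ^ 2 * (ρ o x + s) ^ 2) * (b x y * ρ x y ^ 2) := by
    intro y
    rcases (hb_nonneg x y).eq_or_lt with h0 | hpos
    · simp [← h0]
    have hj := hρ_jump x y hpos
    have h1 := hρ_triangle o x y
    have h2 := hρ_triangle o y x
    rw [hρ_symm y x] at h2
    have hx := hρ_nonneg o x
    have hy := hρ_nonneg o y
    have hxy := hρ_nonneg x y
    have e : W x - W y = b₂ * ((ρ o x - ρ o y) * (ρ o x + ρ o y + 2 * s)) := by
      rw [hW, hW]; ring
    have k1 : (ρ o x - ρ o y) ^ 2 ≤ ρ x y ^ 2 :=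
      sq_le_sq' (by linarith) (by linarith)
    have k2 : (ρ o x + ρ o y + 2 * s) ^ 2 ≤ (3 * (ρ o x + s)) ^ 2 :=
      sq_le_sq' (by linarith) (by linarith)
    have k3 := mul_le_mul k1 k2 (sq_nonneg _) (sq_nonneg _)
    have k4 := mul_le_mul_of_nonneg_left k3 (mul_nonneg hpos.le (sq_nonneg b₂))
    rw [e]
    calc _ = b x y * b₂ ^ 2 * ((ρ o x - ρ o y) ^ 2 * (ρ o x + ρ o y + 2 * s) ^ 2) := by ring
      _ ≤ _ := k4
      _ = _ := by ring
  have hC : 0 ≤ 9 * b₂ ^ 2 * (ρ o x + s) ^ 2 := by positivity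
  have main : gradSq b μ W x ≤ ENNReal.ofReal (9 * b₂ ^ 2 * (ρ o x + s) ^ 2) := by
    unfold gradSq
    have hm0 : ENNReal.ofReal (μ x) ≠ 0 := (ENNReal.ofReal_pos.2 (hμ_pos x)).ne'
    calc _ ≤ (ENNReal.ofReal (μ x))⁻¹ *
          (ENNReal.ofReal (9 * b₂ ^ 2 * (ρ o x + s) ^ 2) * ENNReal.ofReal (μ x)) := by
          gcongr
          calc _ ≤ ∑' y, ENNReal.ofReal (9 * b₂ ^ 2 * (ρ o x + s) ^ 2) *
                ENNReal.ofReal (b x y * ρ x y ^ 2) := by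
                refine ENNReal.tsum_le_tsum fun y => ?_
                rw [← ENNReal.ofReal_mul hC]
                exact ENNReal.ofReal_le_ofReal (hterm y)
            _ ≤ _ := by
                rw [ENNReal.tsum_mul_left]
                gcongr
                exact hρ_intrinsic x
      _ = _ := by
          rw [mul_comm, mul_assoc, ENNReal.mul_inv_cancel hm0 ENNReal.ofReal_ne_top, mul_one]
  refine ⟨main, main.trans (ENNReal.ofReal_le_ofReal ?_)⟩
  rw [hW]
  nlinarith [mul_nonneg hb₂ hb₁]
end
end

section
/- Let (X,b,μ) be a weighted graph and V : X → ℝ. Then (FC) holds if and only if L_V u ∈ ℓ²(X,μ) for every u ∈ C_c(X). -/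
noncomputable section

lemma lapV_off {X : Type*} (b : X → X → ℝ) (μ V : X → ℝ) (u : X → ℂ) (S : Finset X)
    (hS : ∀ y, y ∉ S → u y = 0) (x : X) (hx : u x = 0) :
    lapV b μ V u x = -∑ y ∈ S, ((b x y / μ x : ℝ) : ℂ) * u y := by
  unfold lapV
  rw [tsum_eq_sum (s := S)]
  · rw [hx, Finset.mul_sum, ← Finset.sum_neg_distrib]
    simp only [mul_zero, add_zero]
    refine Finset.sum_congr rfl fun y _ => ?_
    push_cast
    ring
  · intro y hy
    simp [hx, hS y hy]

/-- Let `(X,b,μ)` be a weighted graph and `V : X → ℝ`.  Then (FC) holds (i.e. for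
every `x` the function `y ↦ b(x,y)/μ(y)` belongs to `ℓ²(X,μ)`) if and only if
`L_V u ∈ ℓ²(X,μ)` for every finitely supported `u : X → ℂ`. -/
theorem FC_iff_lapV_mapsTo_l2 {X : Type*} [Countable X]
    (b : X → X → ℝ) (μ : X → ℝ)
    (hb_symm : ∀ x y, b x y = b y x)
    (hb_nonneg : ∀ x y, 0 ≤ b x y)
    (hb_loop : ∀ x, b x x = 0)
    (hb_sum : ∀ x, Summable fun y => b x y)
    (hμ_pos : ∀ x, 0 < μ x)
    (V : X → ℝ) :
    (∀ x, Summable fun y => μ y * (b x y / μ y) ^ 2) ↔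
      ∀ u : X → ℂ, (Function.support u).Finite →
        Summable fun x => μ x * ‖lapV b μ V u x‖ ^ 2 := by
  classical
  constructor
  · intro h u hu
    have hS : ∀ y, y ∉ hu.toFinset → u y = 0 := by
      intro y hy
      simpa using hy
    have hsum : Summable fun x => (hu.toFinset.card : ℝ) *
        ∑ y ∈ hu.toFinset, ‖u y‖ ^ 2 * (μ x * (b y x / μ x) ^ 2) :=
      (summable_sum fun y _ => (h y).mul_left _).mul_left _
    refine Summable.of_norm_bounded_eventually hsum ?_
    filter_upwards [hu.toFinset.finite_toSet.compl_mem_cofinite] with x hx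
    have hx' : x ∉ hu.toFinset := by simpa using hx
    rw [lapV_off b μ V u _ hS x (hS x hx'), norm_neg, Real.norm_of_nonneg
      (mul_nonneg (hμ_pos x).le (sq_nonneg _))]
    have h1 : ‖∑ y ∈ hu.toFinset, ((b x y / μ x : ℝ) : ℂ) * u y‖ ≤
        ∑ y ∈ hu.toFinset, (b y x / μ x) * ‖u y‖ := by
      refine (norm_sum_le _ _).trans (Finset.sum_le_sum fun y _ => ?_)
      rw [norm_mul, Complex.norm_real, Real.norm_of_nonneg
        (div_nonneg (hb_nonneg x y) (hμ_pos x).le), hb_symm x y]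
    calc μ x * ‖∑ y ∈ hu.toFinset, ((b x y / μ x : ℝ) : ℂ) * u y‖ ^ 2
        ≤ μ x * (∑ y ∈ hu.toFinset, (b y x / μ x) * ‖u y‖) ^ 2 := by
          have := (hμ_pos x).le
          gcongr
      _ ≤ μ x * (hu.toFinset.card * ∑ y ∈ hu.toFinset, ((b y x / μ x) * ‖u y‖) ^ 2) :=
          mul_le_mul_of_nonneg_left sq_sum_le_card_mul_sum_sq (hμ_pos x).le
      _ = _ := by
          rw [mul_left_comm, Finset.mul_sum]
          congr 1
          exact Finset.sum_congr rfl fun y _ => by ring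
  · intro h x
    have hx := h (Pi.single x 1) ((Set.finite_singleton x).subset Pi.support_single_subset)
    refine Summable.of_norm_bounded_eventually hx ?_
    filter_upwards [(Set.finite_singleton x).compl_mem_cofinite] with y hy
    have hy' : y ≠ x := by simpa using hy
    rw [lapV_off b μ V _ {x} (fun z hz => by
      simp at hz
      simp [hz]) y (by simp [hy']), Real.norm_of_nonneg
      (mul_nonneg (hμ_pos y).le (sq_nonneg _)), hb_symm x y]
    simp only [Finset.sum_singleton, Pi.single_eq_same, mul_one, norm_neg, Complex.norm_real,
      Real.norm_eq_abs, sq_abs, le_refl]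
end
end

section
/- Consider the triangular graph: X = {(k,j) ∈ ℕ×ℕ : 1 ≤ j ≤ k}, with b((k,i),(k+1,j)) = 1 for all 1 ≤ i ≤ k and 1 ≤ j ≤ k+1 (and b = 0 for all other pairs of distinct vertices, extended symmetrically), weight μ(k,j) = 2·k^{1/2}, and potential V(k,j) = −k^{1/2}. Then the operator L_V restricted to C_c(X) is not semi-bounded from below in ℓ²(X,μ): for every c ∈ ℝ there exists u ∈ C_c(X) with (L_V u, u) < c·‖u‖². -/
noncomputable section

/-- The vertex set of the triangular graph: pairs `(k,j)` of naturals with `1 ≤ j ≤ k`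
(`j`-th vertex of the `k`-th row). -/
def Tri : Type := {p : ℕ × ℕ // 1 ≤ p.2 ∧ p.2 ≤ p.1}

/-- Edge weights of the triangular graph: `b((k,i),(l,j)) = 1` if the rows `k` and `l` are
consecutive, and `0` otherwise. -/
def triB (x y : Tri) : ℝ := if x.1.1 + 1 = y.1.1 ∨ y.1.1 + 1 = x.1.1 then 1 else 0

/-- The weight `μ(k,j) = 2·√k`. -/
def triMu (x : Tri) : ℝ := 2 * Real.sqrt x.1.1

/-- The potential `V(k,j) = −√k`. -/
def triV (x : Tri) : ℝ := -Real.sqrt x.1.1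

/-- The formal discrete Schrödinger operator
`(L_V f)(x) = μ(x)⁻¹ ∑_y b(x,y)(f(x) − f(y)) + V(x) f(x)` on the triangular graph. -/
def triLapV (f : Tri → ℂ) (x : Tri) : ℂ :=
  (triMu x : ℂ)⁻¹ * ∑' y, (triB x y : ℂ) * (f x - f y) + (triV x : ℂ) * f x

/-- The `k`-th row, as a finset. -/
def triRow (k : ℕ) : Finset Tri :=
  (Finset.univ : Finset (Fin k)).map
    ⟨fun i => (⟨(k, i.1 + 1), by simp, i.2⟩ : Tri), fun i j h => by
      have h2 := congrArg (fun t : Tri => t.1.2) h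
      simp at h2
      exact Fin.ext h2⟩

lemma mem_triRow (k : ℕ) (x : Tri) : x ∈ triRow k ↔ x.1.1 = k := by
  unfold triRow
  rw [Finset.mem_map]
  constructor
  · rintro ⟨i, -, rfl⟩
    rfl
  · intro h
    obtain ⟨⟨a, b⟩, h1, h2⟩ := x
    dsimp only at h h1 h2
    subst h
    refine ⟨⟨b - 1, by omega⟩, Finset.mem_univ _, ?_⟩
    apply Subtype.ext
    exact Prod.ext rfl (Nat.sub_add_cancel h1)

lemma card_triRow (k : ℕ) : (triRow k).card = k := by
  simp [triRow]

lemma hasSum_row {𝕜 : Type*} [RCLike 𝕜] (k : ℕ) (a : 𝕜) :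
    HasSum (fun x : Tri => if x.1.1 = k then a else 0) (k * a) := by
  have h : HasSum (fun x : Tri => if x.1.1 = k then a else 0)
      (∑ x ∈ triRow k, if x.1.1 = k then a else 0) := hasSum_sum_of_ne_finset_zero (by
      intro x hx
      rw [mem_triRow] at hx
      simp [hx])
  rw [Finset.sum_congr rfl (g := fun _ => a)] at h
  · simpa [card_triRow] using h
  · intro x hx
    rw [mem_triRow] at hx
    simp [hx]

/-- Indicator function of the rows `p+1` and `p+2`. -/
def triU (p : ℕ) (x : Tri) : ℂ := if x.1.1 = p + 1 ∨ x.1.1 = p + 2 then 1 else 0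

lemma triLap_inner (p : ℕ) (x : Tri) :
    (triMu x : ℂ) * triLapV (triU p) x * star (triU p x) =
      (if x.1.1 = p + 1 then (-(p : ℂ) - 2) else 0) +
      (if x.1.1 = p + 2 then (-(p : ℂ) - 1) else 0) := by
  have hk : (0 : ℝ) < x.1.1 := by
    have := x.2
    exact_mod_cast (by omega : 0 < x.1.1)
  have hs : (0 : ℝ) < Real.sqrt x.1.1 := Real.sqrt_pos.2 hk
  have hmu : (triMu x : ℂ) ≠ 0 := by
    unfold triMu
    exact_mod_cast (by positivity)
  have hV : (triMu x : ℂ) * (triV x : ℂ) = -2 * (x.1.1 : ℂ) := by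
    have : triMu x * triV x = -2 * (x.1.1 : ℝ) := by
      unfold triMu triV
      have := Real.mul_self_sqrt hk.le
      linear_combination (-2) * this
    exact_mod_cast this
  have key : (triMu x : ℂ) * triLapV (triU p) x =
      ∑' y, (triB x y : ℂ) * (triU p x - triU p y) + (-2 * (x.1.1 : ℂ)) * triU p x := by
    unfold triLapV
    rw [mul_add, mul_inv_cancel_left₀ hmu, ← mul_assoc, hV]
  rw [key]
  by_cases h1 : x.1.1 = p + 1
  · have : (fun y => (triB x y : ℂ) * (triU p x - triU p y)) =
        fun y : Tri => if y.1.1 = p then (1 : ℂ) else 0 := by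
      funext y
      unfold triB triU
      rw [h1]
      by_cases hy : y.1.1 = p
      · simp [hy]
      · by_cases hy2 : y.1.1 = p + 2
        · simp [hy2]
        · have a : ¬ (p + 1 + 1 = y.1.1 ∨ y.1.1 + 1 = p + 1) := by omega
          rw [if_neg a, if_neg hy]; simp
    rw [this, (hasSum_row p (1 : ℂ)).tsum_eq]
    simp [triU, h1]
    ring
  · by_cases h2 : x.1.1 = p + 2
    · have : (fun y => (triB x y : ℂ) * (triU p x - triU p y)) =
          fun y : Tri => if y.1.1 = p + 3 then (1 : ℂ) else 0 := by
        funext y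
        unfold triB triU
        rw [h2]
        by_cases hy : y.1.1 = p + 3
        · simp [hy]
        · by_cases hy2 : y.1.1 = p + 1
          · simp [hy2]
          · have a : ¬ (p + 2 + 1 = y.1.1 ∨ y.1.1 + 1 = p + 2) := by omega
            rw [if_neg a, if_neg hy]; simp
      rw [this, (hasSum_row (p + 3) (1 : ℂ)).tsum_eq]
      simp [triU, h2]
      ring
    · simp [triU, h1, h2]

lemma triNorm_term (p : ℕ) (x : Tri) :
    triMu x * ‖triU p x‖ ^ 2 =
      (if x.1.1 = p + 1 then 2 * Real.sqrt (p + 1) else 0) +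
      (if x.1.1 = p + 2 then 2 * Real.sqrt (p + 2) else 0) := by
  unfold triMu triU
  by_cases h1 : x.1.1 = p + 1
  · simp [h1]
  · by_cases h2 : x.1.1 = p + 2 <;> simp [h1, h2]

/-- On the triangular graph with `b ≡ 1` between consecutive rows,
`μ(k,j) = 2·k^{1/2}` and `V(k,j) = −k^{1/2}`, the operator `L_V` restricted to `C_c(X)` is
not semi-bounded from below in `ℓ²(X,μ)`: for every `c ∈ ℝ` there is a finitely supported
`u` with `(L_V u, u) < c·‖u‖²`. -/
theorem triangular_graph_not_semibounded :
    ∀ c : ℝ, ∃ u : Tri → ℂ, (Function.support u).Finite ∧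
      (∑' x, (triMu x : ℂ) * triLapV u x * star (u x)).re <
        c * ∑' x, triMu x * ‖u x‖ ^ 2 := by
  intro c
  obtain ⟨m, hm⟩ := exists_nat_gt (2 * |c| + 2)
  have hc := abs_nonneg c
  have hm2 : 2 ≤ m := by
    have : (2 : ℝ) < m := by linarith
    exact_mod_cast this.le
  obtain ⟨p, hp⟩ : ∃ p, p + 2 = m ^ 2 := ⟨m ^ 2 - 2, Nat.sub_add_cancel (by nlinarith)⟩
  have hpR : (p : ℝ) + 2 = (m : ℝ) ^ 2 := by exact_mod_cast hp
  refine ⟨triU p, ?_, ?_⟩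
  · classical
    refine (triRow (p + 1) ∪ triRow (p + 2)).finite_toSet.subset ?_
    intro x hx
    rw [Finset.mem_coe, Finset.mem_union, mem_triRow, mem_triRow]
    by_contra h
    exact hx (by simp only [triU, if_neg h])
  · rw [tsum_congr (triLap_inner p), tsum_congr (triNorm_term p),
      ((hasSum_row (p + 1) (-(p : ℂ) - 2)).add (hasSum_row (p + 2) (-(p : ℂ) - 1))).tsum_eq,
      ((hasSum_row (p + 1) (2 * Real.sqrt (p + 1))).add
        (hasSum_row (p + 2) (2 * Real.sqrt (p + 2)))).tsum_eq]
    have hre : (((p + 1 : ℕ) : ℂ) * (-(p : ℂ) - 2) + ((p + 2 : ℕ) : ℂ) * (-(p : ℂ) - 1)).re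
        = -2 * ((p : ℝ) + 1) * (p + 2) := by
      rw [show ((p + 1 : ℕ) : ℂ) * (-(p : ℂ) - 2) + ((p + 2 : ℕ) : ℂ) * (-(p : ℂ) - 1)
        = ((-2 * ((p : ℝ) + 1) * (p + 2) : ℝ) : ℂ) by push_cast; ring, Complex.ofReal_re]
    rw [hre]
    push_cast
    have hs2 : Real.sqrt ((p : ℝ) + 2) = m := by
      rw [hpR]; exact Real.sqrt_sq (Nat.cast_nonneg m)
    have hs1 : Real.sqrt ((p : ℝ) + 1) ≤ m := by
      rw [← hs2]; exact Real.sqrt_le_sqrt (by linarith)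
    have hs0 := Real.sqrt_nonneg ((p : ℝ) + 1)
    have hp0 : (0 : ℝ) ≤ p := Nat.cast_nonneg p
    have hm0 : (0 : ℝ) ≤ m := Nat.cast_nonneg m
    rw [hs2]
    set S : ℝ := ((p : ℝ) + 1) * (2 * Real.sqrt (p + 1)) + (p + 2) * (2 * m) with hS
    have hS0 : 0 ≤ S := by positivity
    have hS1 : S ≤ (p + 2) * (4 * m) := by
      have : ((p : ℝ) + 1) * (2 * Real.sqrt (p + 1)) ≤ (p + 2) * (2 * m) := by
        gcongr
        linarith
      rw [hS]; linarith
    have h1 : -(|c| * S) ≤ c * S := by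
      have := mul_le_mul_of_nonneg_right (neg_abs_le c) hS0
      linarith
    have h2 : |c| * S ≤ |c| * ((p + 2) * (4 * m)) := mul_le_mul_of_nonneg_left hS1 hc
    have h3 : 2 * |c| * m < (p : ℝ) + 1 := by nlinarith
    have h4 : (2 * |c| * m) * (2 * ((p : ℝ) + 2)) < ((p : ℝ) + 1) * (2 * ((p : ℝ) + 2)) :=
      mul_lt_mul_of_pos_right h3 (by positivity)
    linarith
end
end
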